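/- arXiv:math/0506466 — 4 statements merged into one kernel-verified Lean document; each statement's English description precedes it below -/
import Mathlib

section
/- For every rational polyhedral cone K ⊆ ℝ^d, i.e., every set of the form K = v + ℝ_{≥0}w_1 + ⋯ + ℝ_{≥0}w_n with v ∈ ℝ^d and w_1, …, w_n ∈ ℤ^d, the integer-point generating series S_K lies in the module PL of polyhedral Laurent series; equivalently, the indicator function of K∩ℤ^d is a finite ℂ[x_1^{±1},…,x_d^{±1}]-linear combination of the series S_{K'} of simple rational cones K'. -/
open scoped BigOperators Classical

noncomputable section

/-- The real vector corresponding to an integer vector. -/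
def toR (d : ℕ) (m : Fin d → ℤ) : Fin d → ℝ := fun i => (m i : ℝ)

/-- The standard dot product on `ℝ^d`. -/
def dotR (d : ℕ) (x y : Fin d → ℝ) : ℝ := ∑ i, x i * y i

/-- Laurent polynomials `ℂ[x₁^{±1},…,x_d^{±1}]`, represented by their coefficient functions. -/
abbrev LaurentPoly (d : ℕ) := (Fin d → ℤ) →₀ ℂ

/-- The integer-point generating series of a subset of `ℝ^d`: the function `ℤ^d → ℂ`
equal to `1` on `S ∩ ℤ^d` and `0` elsewhere. -/
def genSeries (d : ℕ) (S : Set (Fin d → ℝ)) : (Fin d → ℤ) → ℂ :=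
  fun m => if toR d m ∈ S then 1 else 0

/-- The action of a Laurent polynomial on a formal Laurent series,
`(x^w · S)(m) = S(m - w)` extended linearly. -/
def actLP (d : ℕ) (g : LaurentPoly d) (S : (Fin d → ℤ) → ℂ) : (Fin d → ℤ) → ℂ :=
  fun m => ∑ w ∈ g.support, g w * S (m - w)

/-- The series of a Laurent polynomial `f`, i.e. `Σ_m f_m x^m` as a formal series. -/
def seriesOf (d : ℕ) (f : LaurentPoly d) : (Fin d → ℤ) → ℂ := fun m => f m

/-- The cone `v + ℝ_{≥0} w₁ + ⋯ + ℝ_{≥0} w_n`. -/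
def coneSet (d n : ℕ) (v : Fin d → ℝ) (w : Fin n → Fin d → ℤ) : Set (Fin d → ℝ) :=
  {y | ∃ lam : Fin n → ℝ, (∀ i, 0 ≤ lam i) ∧ y = v + ∑ i, lam i • toR d (w i)}

/-- The fundamental half-open parallelepiped `{v + Σ λᵢ wᵢ : 0 ≤ λᵢ < 1}`. -/
def parSet (d : ℕ) (v : Fin d → ℝ) (w : Fin d → Fin d → ℤ) : Set (Fin d → ℝ) :=
  {y | ∃ lam : Fin d → ℝ, (∀ i, 0 ≤ lam i ∧ lam i < 1) ∧ y = v + ∑ i, lam i • toR d (w i)}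

/-- A simple rational cone: `v + ℝ_{≥0} w₁ + ⋯ + ℝ_{≥0} w_d` with `w₁,…,w_d ∈ ℤ^d`
linearly independent. -/
def IsSimpleCone (d : ℕ) (K : Set (Fin d → ℝ)) : Prop :=
  ∃ (v : Fin d → ℝ) (w : Fin d → Fin d → ℤ),
    LinearIndependent ℝ (fun i => toR d (w i)) ∧ K = coneSet d d v w

/-- Membership in the module `PL` of polyhedral Laurent series: a finite
`ℂ[x₁^{±1},…,x_d^{±1}]`-linear combination of the series of simple rational cones. -/
def MemPL (d : ℕ) (S : (Fin d → ℤ) → ℂ) : Prop :=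
  ∃ (n : ℕ) (g : Fin n → LaurentPoly d) (K : Fin n → Set (Fin d → ℝ)),
    (∀ i, IsSimpleCone d (K i)) ∧ S = ∑ i, actLP d (g i) (genSeries d (K i))

/-- The field of rational functions `ℂ(x₁,…,x_d)`. -/
abbrev RatF (d : ℕ) := FractionRing (MvPolynomial (Fin d) ℂ)

/-- The monomial `x^w`, `w ∈ ℤ^d`, as a rational function. -/
def ratMon (d : ℕ) (w : Fin d → ℤ) : RatF d :=
  ∏ i, (algebraMap (MvPolynomial (Fin d) ℂ) (RatF d) (MvPolynomial.X i)) ^ (w i)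

/-- A Laurent polynomial as a rational function. -/
def toRat (d : ℕ) (g : LaurentPoly d) : RatF d :=
  ∑ w ∈ g.support, algebraMap (MvPolynomial (Fin d) ℂ) (RatF d) (MvPolynomial.C (g w)) * ratMon d w

/-- `σ_S(x) = Σ_{m ∈ S ∩ ℤ^d} x^m`, as a rational function (for `S` with finitely many
integer points). -/
def sigmaSet (d : ℕ) (S : Set (Fin d → ℝ)) : RatF d :=
  ∑ᶠ m ∈ {m : Fin d → ℤ | toR d m ∈ S}, ratMon d m

/-- `φ : PL → ℂ(x₁,…,x_d)` is the `ℂ[x₁^{±1},…,x_d^{±1}]`-module homomorphism sending the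
series `S_K` of a simple rational cone `K` to `σ_{P_K}(x) / Π (1 - x^{wᵢ})`. -/
def IsPhi (d : ℕ) (φ : ((Fin d → ℤ) → ℂ) → RatF d) : Prop :=
  (∀ S T, MemPL d S → MemPL d T → φ (S + T) = φ S + φ T) ∧
  (∀ (g : LaurentPoly d) (S), MemPL d S → φ (actLP d g S) = toRat d g * φ S) ∧
  (∀ (v : Fin d → ℝ) (w : Fin d → Fin d → ℤ),
      LinearIndependent ℝ (fun i => toR d (w i)) →
      φ (genSeries d (coneSet d d v w)) =
        sigmaSet d (parSet d v w) / ∏ i, (1 - ratMon d (w i)))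

/-- A convex polyhedron: an intersection of finitely many closed halfspaces. -/
def IsPolyhedron (d : ℕ) (P : Set (Fin d → ℝ)) : Prop :=
  ∃ (n : ℕ) (a : Fin n → Fin d → ℝ) (b : Fin n → ℝ),
    P = {y | ∀ i, dotR d (a i) y ≤ b i}

/-- The polar `P^∨ = {x : ⟨x,y⟩ ≤ 1 for all y ∈ P}`. -/
def polar (d : ℕ) (P : Set (Fin d → ℝ)) : Set (Fin d → ℝ) :=
  {x | ∀ y ∈ P, dotR d x y ≤ 1}

/-- The pairing `⟨l, x⟩` of an integer vector `l` with a real vector `x`. -/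
def evalAt {d : ℕ} (x : Fin d → ℝ) : (Fin d → ℤ) →ₗ[ℤ] ℝ where
  toFun l := ∑ i, (l i : ℝ) * x i
  map_add' a b := by simp [add_mul, Finset.sum_add_distrib]
  map_smul' c a := by simp [Finset.mul_sum, mul_assoc]

lemma evalAt_apply {d : ℕ} (x : Fin d → ℝ) (l : Fin d → ℤ) :
    evalAt x l = ∑ i, (l i : ℝ) * x i := rfl

lemma evalAt_add {d : ℕ} (x y : Fin d → ℝ) (l : Fin d → ℤ) :
    evalAt (x + y) l = evalAt x l + evalAt y l := by
  simp [evalAt_apply, mul_add, Finset.sum_add_distrib]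

lemma evalAt_sub {d : ℕ} (x y : Fin d → ℝ) (l : Fin d → ℤ) :
    evalAt (x - y) l = evalAt x l - evalAt y l := by
  simp [evalAt_apply, mul_sub, Finset.sum_sub_distrib]

lemma evalAt_smul {d : ℕ} (t : ℝ) (x : Fin d → ℝ) (l : Fin d → ℤ) :
    evalAt (t • x) l = t * evalAt x l := by
  simp [evalAt_apply, Finset.mul_sum, mul_left_comm]

lemma evalAt_zsmul {d : ℕ} (x : Fin d → ℝ) (c : ℤ) (l : Fin d → ℤ) :
    evalAt x (c • l) = c * evalAt x l := by
  rw [map_smul, zsmul_eq_mul]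

lemma evalAt_toR {d : ℕ} (m l : Fin d → ℤ) : evalAt (toR d m) l = ((l ⬝ᵥ m : ℤ) : ℝ) := by
  simp [evalAt_apply, toR, dotProduct]

lemma evalAt_single {d : ℕ} (x : Fin d → ℝ) (i : Fin d) (c : ℤ) :
    evalAt x (Pi.single i c) = c * x i := by
  rw [evalAt_apply, Finset.sum_eq_single i]
  · simp
  · intro j _ hj
    simp [Pi.single_eq_of_ne hj]
  · simp

/-- The cone cut out by finitely many homogeneous integral inequalities. -/
def dualCone {d : ℕ} (F : Finset (Fin d → ℤ)) : Set (Fin d → ℝ) :=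
  {x | ∀ l ∈ F, 0 ≤ evalAt x l}

/-- Fourier–Motzkin elimination: adding a ray to a cone cut out by integral inequalities. -/
lemma exists_dualCone_add_ray {d : ℕ} (F : Finset (Fin d → ℤ)) (u : Fin d → ℤ) :
    ∃ G : Finset (Fin d → ℤ), ∀ x : Fin d → ℝ,
      x ∈ dualCone G ↔ ∃ t : ℝ, 0 ≤ t ∧ x - t • toR d u ∈ dualCone F := by
  set A := F.filter (fun l => 0 ≤ l ⬝ᵥ u) with hA
  set B := (F ×ˢ F).filter (fun p => p.1 ⬝ᵥ u < 0 ∧ 0 < p.2 ⬝ᵥ u) with hB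
  refine ⟨A ∪ B.image (fun p => (p.2 ⬝ᵥ u) • p.1 - (p.1 ⬝ᵥ u) • p.2), fun x => ?_⟩
  constructor
  · intro hx
    have h1 : ∀ l ∈ F, 0 ≤ l ⬝ᵥ u → 0 ≤ evalAt x l := fun l hl h =>
      hx l (by simp [hA, hl, h])
    have h2 : ∀ k ∈ F, ∀ l ∈ F, k ⬝ᵥ u < 0 → 0 < l ⬝ᵥ u →
        ((k ⬝ᵥ u : ℤ) : ℝ) * evalAt x l ≤ ((l ⬝ᵥ u : ℤ) : ℝ) * evalAt x k := by
      intro k hk l hl hku hlu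
      have := hx ((l ⬝ᵥ u) • k - (k ⬝ᵥ u) • l) (by
        apply Finset.mem_union_right
        exact Finset.mem_image.2 ⟨(k, l), by simp [hB, hk, hl, hku, hlu], rfl⟩)
      rw [map_sub, evalAt_zsmul, evalAt_zsmul] at this
      linarith
    -- the least admissible parameter is the maximum of the lower bounds
    set L : Finset ℝ := insert 0 ((F.filter (fun l => l ⬝ᵥ u < 0)).image
      (fun l => evalAt x l / ((l ⬝ᵥ u : ℤ) : ℝ))) with hL
    have hne : L.Nonempty := ⟨0, by simp [hL]⟩
    refine ⟨L.max' hne, L.le_max' 0 (by simp [hL]), fun l hl => ?_⟩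
    rw [evalAt_sub, evalAt_smul, evalAt_toR, sub_nonneg]
    rcases lt_trichotomy (l ⬝ᵥ u) 0 with h | h | h
    · have h' : ((l ⬝ᵥ u : ℤ) : ℝ) < 0 := by exact_mod_cast h
      rw [← div_le_iff_of_neg h']
      apply L.le_max'
      simp only [hL, Finset.mem_insert, Finset.mem_image, Finset.mem_filter]
      exact Or.inr ⟨l, ⟨hl, h⟩, rfl⟩
    · rw [h]
      simpa using h1 l hl h.ge
    · have h' : (0 : ℝ) < ((l ⬝ᵥ u : ℤ) : ℝ) := by exact_mod_cast h
      rw [← le_div_iff₀ h']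
      apply L.max'_le
      intro y hy
      simp only [hL, Finset.mem_insert, Finset.mem_image, Finset.mem_filter] at hy
      rcases hy with rfl | ⟨k, ⟨hk, hku⟩, rfl⟩
      · exact div_nonneg (h1 l hl h.le) h'.le
      · have hk' : ((k ⬝ᵥ u : ℤ) : ℝ) < 0 := by exact_mod_cast hku
        rw [div_le_iff_of_neg hk', div_mul_eq_mul_div, div_le_iff₀ h']
        linarith [h2 k hk l hl hku h]
  · rintro ⟨t, ht, hx⟩
    have hx' : ∀ l ∈ F, t * ((l ⬝ᵥ u : ℤ) : ℝ) ≤ evalAt x l := by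
      intro l hl
      have := hx l hl
      rw [evalAt_sub, evalAt_smul, evalAt_toR] at this
      linarith
    intro l hl
    rcases Finset.mem_union.1 hl with hl | hl
    · obtain ⟨hl, h⟩ := Finset.mem_filter.1 hl
      have h' : (0 : ℝ) ≤ ((l ⬝ᵥ u : ℤ) : ℝ) := by exact_mod_cast h
      exact (mul_nonneg ht h').trans (hx' l hl)
    · obtain ⟨⟨k, l⟩, hp, rfl⟩ := Finset.mem_image.1 hl
      simp only [hB, Finset.mem_filter, Finset.mem_product] at hp
      obtain ⟨⟨hk, hl⟩, hku, hlu⟩ := hp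
      have hk' : ((k ⬝ᵥ u : ℤ) : ℝ) < 0 := by exact_mod_cast hku
      have hl' : (0 : ℝ) < ((l ⬝ᵥ u : ℤ) : ℝ) := by exact_mod_cast hlu
      dsimp only
      rw [map_sub, evalAt_zsmul, evalAt_zsmul]
      have h1 := mul_le_mul_of_nonneg_left (hx' k hk) hl'.le
      have h2 := mul_le_mul_of_nonpos_left (hx' l hl) hk'.le
      linarith

/-- Weyl's theorem over the integers: a cone generated by integer vectors is cut out by
finitely many integral inequalities. -/
lemma exists_coneSet_eq_dualCone (d n : ℕ) (v : Fin d → ℝ) (w : Fin n → Fin d → ℤ) :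
    ∃ F : Finset (Fin d → ℤ), ∀ x, x ∈ coneSet d n v w ↔ x - v ∈ dualCone F := by
  induction n with
  | zero =>
    refine ⟨Finset.univ.image (fun i => Pi.single i 1) ∪
      Finset.univ.image (fun i => Pi.single i (-1)), fun x => ?_⟩
    constructor
    · rintro ⟨lam, -, rfl⟩ l -
      simp [evalAt_apply]
    · intro h
      refine ⟨0, by simp, ?_⟩
      simp only [Finset.univ_eq_empty, Finset.sum_empty, add_zero]
      rw [← sub_eq_zero]
      ext i
      have h1 := h (Pi.single i 1) (by simp)
      have h2 := h (Pi.single i (-1)) (by simp)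
      rw [evalAt_single] at h1 h2
      push_cast at h1 h2
      simp only [Pi.zero_apply]
      linarith
  | succ n ih =>
    obtain ⟨F, hF⟩ := ih (fun i => w i.succ)
    obtain ⟨G, hG⟩ := exists_dualCone_add_ray F (w 0)
    refine ⟨G, fun x => ?_⟩
    rw [hG]
    constructor
    · rintro ⟨lam, h0, rfl⟩
      refine ⟨lam 0, h0 0, ?_⟩
      have := (hF (v + ∑ i : Fin n, lam i.succ • toR d (w i.succ))).1
        ⟨fun i => lam i.succ, fun i => h0 _, rfl⟩
      convert this using 1
      rw [Fin.sum_univ_succ]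
      abel
    · rintro ⟨t, ht, hx⟩
      have := (hF (x - t • toR d (w 0))).2 (by convert hx using 1; abel)
      obtain ⟨lam, h0, h⟩ := this
      refine ⟨Fin.cons t lam, fun i => ?_, ?_⟩
      · refine Fin.cases ?_ (fun j => ?_) i
        · simpa using ht
        · simpa using h0 j
      · rw [Fin.sum_univ_succ]
        simp only [Fin.cons_zero, Fin.cons_succ]
        rw [sub_eq_iff_eq_add] at h
        rw [h]
        abel

/-- A set of values prescribed for one coordinate: no condition, nonnegativity, or vanishing. -/
def IsCoordSet (T : Set ℝ) : Prop := T = Set.univ ∨ T = Set.Ici 0 ∨ T = {0}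

/-- The cone obtained by prescribing conditions on the coordinates `⟨N k, x⟩`. -/
def cell {d : ℕ} (N : Matrix (Fin d) (Fin d) ℤ) (T : Fin d → Set ℝ) : Set (Fin d → ℝ) :=
  {x | ∀ k, evalAt x (N k) ∈ T k}

lemma mem_cell_update {d : ℕ} (N : Matrix (Fin d) (Fin d) ℤ) (T : Fin d → Set ℝ)
    (i : Fin d) (r : Fin d → ℤ) (U : Set ℝ) (x : Fin d → ℝ) :
    x ∈ cell (N.updateRow i r) (Function.update T i U) ↔
      evalAt x r ∈ U ∧ ∀ k, k ≠ i → evalAt x (N k) ∈ T k := by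
  constructor
  · intro h
    refine ⟨by simpa using h i, fun k hk => ?_⟩
    simpa [Matrix.updateRow_ne hk, Function.update_of_ne hk] using h k
  · rintro ⟨h1, h2⟩ k
    by_cases hk : k = i
    · subst hk
      simpa using h1
    · simpa [Matrix.updateRow_ne hk, Function.update_of_ne hk] using h2 k hk

/-- Coefficients of the functional `∑ k, c k • N k` after replacing the `i`-th row of `N` by
`s • (c i • N i + c j • N j)`, where `s = ±1`. -/
lemma sum_update_pair {d : ℕ} (N : Matrix (Fin d) (Fin d) ℤ) (c : Fin d → ℤ) {i j : Fin d}
    (hij : i ≠ j) {s : ℤ} (hs : s * s = 1) (x : Fin d → ℝ) :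
    ∑ k, (Function.update (Function.update c i s) j 0 k : ℝ) *
        evalAt x (N.updateRow i (s • (c i • N i + c j • N j)) k) =
      ∑ k, (c k : ℝ) * evalAt x (N k) := by
  have hs' : (s : ℝ) * s = 1 := by exact_mod_cast hs
  rw [← sub_eq_zero, ← Finset.sum_sub_distrib,
    Finset.sum_eq_add_of_mem i j (Finset.mem_univ _) (Finset.mem_univ _) hij]
  · rw [Function.update_of_ne hij]
    simp only [Function.update_self, Matrix.updateRow_self, map_add, evalAt_zsmul,
      Matrix.updateRow_ne hij.symm]
    push_cast
    linear_combination (c i * evalAt x (N i) + c j * evalAt x (N j)) * hs'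
  · rintro k - ⟨hki, hkj⟩
    rw [Function.update_of_ne hkj, Function.update_of_ne hki, Matrix.updateRow_ne hki, sub_self]

lemma det_updateRow_pair {d : ℕ} (N : Matrix (Fin d) (Fin d) ℤ) {i j : Fin d}
    (hij : i ≠ j) (s a b : ℤ) :
    (N.updateRow i (s • (a • N i + b • N j))).det = s * a * N.det := by
  rw [Matrix.det_updateRow_smul, Matrix.det_updateRow_add, Matrix.det_updateRow_smul,
    Matrix.det_updateRow_smul, Matrix.updateRow_eq_self, Matrix.det_updateRow_eq_zero hij.symm]
  ring

/-- A property of sets which holds for all cells and is stable under valuative unions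
holds for intersections of cells with integral half-spaces. -/
lemma cell_inter_coord_halfspace {d : ℕ} (P : Set (Fin d → ℝ) → Prop)
    (hU : ∀ X Y, P X → P Y → P (X ∩ Y) → P (X ∪ Y))
    (hcell : ∀ (N : Matrix (Fin d) (Fin d) ℤ) T, N.det ≠ 0 → (∀ k, IsCoordSet (T k)) →
      P (cell N T)) (n : ℕ) :
    ∀ (N : Matrix (Fin d) (Fin d) ℤ) (T : Fin d → Set ℝ) (c : Fin d → ℤ), N.det ≠ 0 →
      (∀ k, IsCoordSet (T k)) →
      (Finset.univ.filter (fun k => T k = Set.Ici 0 ∧ c k ≠ 0)).card = n →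
      P (cell N T ∩ {x | 0 ≤ ∑ k, (c k : ℝ) * evalAt x (N k)}) := by
  induction n using Nat.strong_induction_on with
  | _ n ih =>
  intro N T c hN hT hn
  have hupd : ∀ i U, IsCoordSet U → ∀ k, IsCoordSet (Function.update T i U k) := by
    intro i U hUc k
    by_cases hk : k = i
    · subst hk; simpa using hUc
    · simpa [Function.update_of_ne hk] using hT k
  by_cases hfree : ∃ k, T k = Set.univ ∧ c k ≠ 0
  · -- a free coordinate can be replaced by the functional itself
    obtain ⟨k, hk, hck⟩ := hfree
    have hdet : (N.updateRow k (∑ i, c i • N i)).det ≠ 0 := by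
      rw [Matrix.det_updateRow_sum]
      exact mul_ne_zero hck hN
    convert hcell _ (Function.update T k (Set.Ici 0)) hdet
      (hupd k _ (Or.inr (Or.inl rfl))) using 1
    ext x
    rw [mem_cell_update]
    simp only [map_sum, evalAt_zsmul, Set.mem_inter_iff, Set.mem_ofPred_eq, Set.mem_Ici]
    constructor
    · rintro ⟨h1, h2⟩
      exact ⟨h2, fun i _ => h1 i⟩
    · rintro ⟨h1, h2⟩
      refine ⟨fun i => ?_, h1⟩
      by_cases hi : i = k
      · subst hi; rw [hk]; trivial
      · exact h2 i hi
  have hfree' : ∀ k, T k = Set.univ → c k = 0 := by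
    intro k hk
    by_contra hc
    exact hfree ⟨k, hk, hc⟩
  by_cases hmix : ∃ i j, T i = Set.Ici 0 ∧ T j = Set.Ici 0 ∧ 0 < c i ∧ c j < 0
  · obtain ⟨i, j, hTi, hTj, hci, hcj⟩ := hmix
    -- one coordinate of a pair with coefficients of opposite signs is traded for
    -- the contribution of the pair
    have key : ∀ (i j : Fin d) (s : ℤ) (U : Set ℝ), T i = Set.Ici 0 → T j = Set.Ici 0 →
        s * s = 1 → 0 < s * c i → s * c j < 0 → IsCoordSet U → U ⊆ Set.Ici 0 →
        P ((cell N T ∩ {x | (s : ℝ) * (c i * evalAt x (N i) + c j * evalAt x (N j)) ∈ U}) ∩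
          {x | 0 ≤ ∑ k, (c k : ℝ) * evalAt x (N k)}) := by
      intro i j s U hTi hTj hs hsi hsj hUc hU0
      have hij : i ≠ j := by rintro rfl; omega
      have hs0 : s ≠ 0 := by rintro rfl; simp at hs
      have hdet : (N.updateRow i (s • (c i • N i + c j • N j))).det ≠ 0 := by
        rw [det_updateRow_pair N hij]
        exact mul_ne_zero hsi.ne' hN
      have hcard : (Finset.univ.filter (fun k => Function.update T i U k = Set.Ici 0 ∧
          Function.update (Function.update c i s) j 0 k ≠ 0)).card < n := by
        rw [← hn]
        apply Finset.card_lt_card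
        rw [Finset.ssubset_iff_of_subset]
        · refine ⟨j, ?_, ?_⟩
          · simp only [Finset.mem_filter, Finset.mem_univ, true_and]
            refine ⟨hTj, ?_⟩
            rintro h
            simp [h] at hsj
          · simp
        · intro k
          simp only [Finset.mem_filter, Finset.mem_univ, true_and]
          by_cases hkj : k = j
          · subst hkj; simp
          by_cases hki : k = i
          · subst hki
            intro _
            refine ⟨hTi, ?_⟩
            rintro h
            simp [h] at hsi
          · simp [Function.update_of_ne hkj, Function.update_of_ne hki]
      have := ih _ hcard _ _ _ hdet (hupd i U hUc) rfl
      simp only [sum_update_pair N c hij hs] at this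
      convert this using 2
      ext x
      rw [mem_cell_update]
      simp only [map_add, evalAt_zsmul, Set.mem_inter_iff, Set.mem_ofPred_eq]
      constructor
      · rintro ⟨h1, h2⟩
        exact ⟨h2, fun k _ => h1 k⟩
      · rintro ⟨h1, h2⟩
        refine ⟨fun k => ?_, h1⟩
        by_cases hk : k = i
        · subst hk
          have hj := h2 j hij.symm
          have hz := hU0 h1
          rw [hTj, Set.mem_Ici] at hj
          rw [Set.mem_Ici] at hz
          rw [hTi, Set.mem_Ici]
          have hsi' : (0 : ℝ) < s * c k := by exact_mod_cast hsi
          have hsj' : (s * c j : ℝ) < 0 := by exact_mod_cast hsj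
          by_contra hneg
          push Not at hneg
          nlinarith [mul_neg_of_pos_of_neg hsi' hneg, mul_nonneg (neg_nonneg.2 hsj'.le) hj]
        · exact h2 k hk
    have hX := key i j 1 (Set.Ici 0) hTi hTj rfl (by omega) (by omega) (Or.inr (Or.inl rfl))
      subset_rfl
    have hY := key j i (-1) (Set.Ici 0) hTj hTi rfl (by omega) (by omega) (Or.inr (Or.inl rfl))
      subset_rfl
    have hZ := key i j 1 {0} hTi hTj rfl (by omega) (by omega) (Or.inr (Or.inr rfl)) (by simp)
    convert hU _ _ hX hY ?_ using 1
    · ext x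
      simp only [Set.mem_inter_iff, Set.mem_union, Set.mem_ofPred_eq, Set.mem_Ici]
      push_cast
      rcases le_total 0 ((c i : ℝ) * evalAt x (N i) + c j * evalAt x (N j)) with h | h
      · have : (0 : ℝ) ≤ 1 * (c i * evalAt x (N i) + c j * evalAt x (N j)) := by linarith
        tauto
      · have : (0 : ℝ) ≤ -1 * (c j * evalAt x (N j) + c i * evalAt x (N i)) := by linarith
        tauto
    · convert hZ using 1
      ext x
      simp only [Set.mem_inter_iff, Set.mem_ofPred_eq, Set.mem_Ici, Set.mem_singleton_iff]
      push_cast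
      constructor
      · rintro ⟨⟨⟨h1, h2⟩, h3⟩, ⟨_, h4⟩, _⟩
        exact ⟨⟨h1, by linarith⟩, h3⟩
      · rintro ⟨⟨h1, h2⟩, h3⟩
        exact ⟨⟨⟨h1, by linarith⟩, h3⟩, ⟨h1, by linarith⟩, h3⟩
  -- no mixed signs
  have hzero : ∀ x ∈ cell N T, ∀ k, T k ≠ Set.Ici 0 → (c k : ℝ) * evalAt x (N k) = 0 := by
    intro x hx k hk
    rcases hT k with h | h | h
    · simp [hfree' k h]
    · exact absurd h hk
    · have := hx k
      rw [h, Set.mem_singleton_iff] at this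
      simp [this]
  by_cases hneg : ∃ j, T j = Set.Ici 0 ∧ c j < 0
  · obtain ⟨j, hTj, hcj⟩ := hneg
    have hle : ∀ i, T i = Set.Ici 0 → c i ≤ 0 := by
      intro i hi
      by_contra h
      exact hmix ⟨i, j, hi, hTj, not_le.1 h, hcj⟩
    convert hcell N (fun k => if T k = Set.Ici 0 ∧ c k ≠ 0 then {0} else T k) hN ?_ using 1
    · ext x
      constructor
      · rintro ⟨hx, hs⟩ k
        rw [Set.mem_ofPred_eq] at hs
        have hnp : ∀ k ∈ Finset.univ, (c k : ℝ) * evalAt x (N k) ≤ 0 := by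
          intro k _
          by_cases hk : T k = Set.Ici 0
          · have h1 := hx k
            rw [hk] at h1
            exact mul_nonpos_of_nonpos_of_nonneg (by exact_mod_cast hle k hk) h1
          · exact (hzero x hx k hk).le
        have hz := (Finset.sum_eq_zero_iff_of_nonpos hnp).1
          (le_antisymm (Finset.sum_nonpos hnp) hs) k (Finset.mem_univ _)
        dsimp only
        split_ifs with hk
        · exact (mul_eq_zero.1 hz).resolve_left (by exact_mod_cast hk.2)
        · exact hx k
      · intro hx
        have hx1 : ∀ k, (T k = Set.Ici 0 ∧ c k ≠ 0) → evalAt x (N k) = 0 := by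
          intro k hk
          have := hx k
          simpa [hk] using this
        have hx2 : x ∈ cell N T := by
          intro k
          by_cases hk : T k = Set.Ici 0 ∧ c k ≠ 0
          · rw [hx1 k hk, hk.1]
            exact Set.self_mem_Ici
          · have := hx k
            simpa only [if_neg hk] using this
        refine ⟨hx2, ?_⟩
        rw [Set.mem_ofPred_eq, Finset.sum_eq_zero]
        intro k _
        by_cases hk : T k = Set.Ici 0
        · by_cases hc : c k = 0
          · simp [hc]
          · simp [hx1 k ⟨hk, hc⟩]
        · exact hzero x hx2 k hk
    · intro k
      split_ifs
      · exact Or.inr (Or.inr rfl)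
      · exact hT k
  · convert hcell N T hN hT using 1
    rw [Set.inter_eq_left]
    intro x hx
    rw [Set.mem_ofPred_eq]
    refine Finset.sum_nonneg fun k _ => ?_
    by_cases hk : T k = Set.Ici 0
    · have h1 := hx k
      rw [hk] at h1
      refine mul_nonneg ?_ h1
      have : 0 ≤ c k := by
        by_contra h
        exact hneg ⟨k, hk, not_le.1 h⟩
      exact_mod_cast this
    · exact (hzero x hx k hk).ge

lemma cell_inter_halfspace {d : ℕ} (P : Set (Fin d → ℝ) → Prop)
    (hU : ∀ X Y, P X → P Y → P (X ∩ Y) → P (X ∪ Y))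
    (hcell : ∀ (N : Matrix (Fin d) (Fin d) ℤ) T, N.det ≠ 0 → (∀ k, IsCoordSet (T k)) →
      P (cell N T)) (N : Matrix (Fin d) (Fin d) ℤ) (T : Fin d → Set ℝ) (hN : N.det ≠ 0)
    (hT : ∀ k, IsCoordSet (T k)) (l : Fin d → ℤ) :
    P (cell N T ∩ {x | 0 ≤ evalAt x l}) := by
  convert cell_inter_coord_halfspace P hU hcell _ N T (N.det • Matrix.vecMul l N.adjugate)
    hN hT rfl using 2
  ext x
  have h1 : ∑ k, (N.det • Matrix.vecMul l N.adjugate) k • N k = (N.det * N.det) • l := by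
    have : ∑ k, (N.det • Matrix.vecMul l N.adjugate) k • N k =
        Matrix.vecMul (N.det • Matrix.vecMul l N.adjugate) N := by
      ext j
      simp [Matrix.vecMul, dotProduct]
    rw [this, Matrix.smul_vecMul, Matrix.vecMul_vecMul, Matrix.adjugate_mul,
      Matrix.vecMul_smul, Matrix.vecMul_one, smul_smul]
  have h2 := congrArg (evalAt x) h1
  simp only [map_sum, evalAt_zsmul] at h2
  rw [Set.mem_ofPred_eq, Set.mem_ofPred_eq, h2]
  have : (0 : ℝ) < ((N.det * N.det : ℤ) : ℝ) := by
    exact_mod_cast mul_self_pos.2 hN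
  exact (mul_nonneg_iff_of_pos_left this).symm

lemma cell_inter_dualCone {d : ℕ} (P : Set (Fin d → ℝ) → Prop)
    (hU : ∀ X Y, P X → P Y → P (X ∩ Y) → P (X ∪ Y))
    (hcell : ∀ (N : Matrix (Fin d) (Fin d) ℤ) T, N.det ≠ 0 → (∀ k, IsCoordSet (T k)) →
      P (cell N T)) (F : Finset (Fin d → ℤ)) :
    ∀ (N : Matrix (Fin d) (Fin d) ℤ) T, N.det ≠ 0 → (∀ k, IsCoordSet (T k)) →
      P (cell N T ∩ dualCone F) := by
  induction F using Finset.induction_on with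
  | empty =>
    intro N T hN hT
    simpa [dualCone] using hcell N T hN hT
  | insert l F _ ih =>
    intro N T hN hT
    have := cell_inter_halfspace (fun X => P (X ∩ dualCone F)) (fun X Y hX hY hXY => by
      rw [Set.union_inter_distrib_right]
      refine hU _ _ hX hY ?_
      rwa [← Set.inter_inter_distrib_right]) ih N T hN hT l
    convert this using 1
    ext x
    simp [dualCone, and_assoc]

/-- A property of sets which holds for all cells and is stable under valuative unions
holds for all cones cut out by integral inequalities. -/
lemma dualCone_induction {d : ℕ} (P : Set (Fin d → ℝ) → Prop)
    (hU : ∀ X Y, P X → P Y → P (X ∩ Y) → P (X ∪ Y))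
    (hcell : ∀ (N : Matrix (Fin d) (Fin d) ℤ) T, N.det ≠ 0 → (∀ k, IsCoordSet (T k)) →
      P (cell N T)) (F : Finset (Fin d → ℤ)) : P (dualCone F) := by
  simpa [cell] using cell_inter_dualCone P hU hcell F 1 (fun _ => Set.univ) (by simp)
    (fun _ => Or.inl rfl)

/-- The `ℂ`-span of the generating series of simple cones. -/
def simpleSpan (d : ℕ) : Submodule ℂ ((Fin d → ℤ) → ℂ) :=
  Submodule.span ℂ {S | ∃ K, IsSimpleCone d K ∧ S = genSeries d K}

lemma actLP_single_zero (d : ℕ) (c : ℂ) (S : (Fin d → ℤ) → ℂ) :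
    actLP d (Finsupp.single 0 c) S = c • S := by
  ext m
  have := Finsupp.sum_single_index (a := (0 : Fin d → ℤ)) (b := c)
    (h := fun w a => a * S (m - w)) (by simp)
  simpa [Finsupp.sum, actLP] using this

lemma memPL_of_mem_simpleSpan {d : ℕ} {S : (Fin d → ℤ) → ℂ} (hS : S ∈ simpleSpan d) :
    MemPL d S := by
  obtain ⟨n, f, g, h⟩ := (Submodule.mem_span_set' (R := ℂ)).1 hS
  choose K hK hg using fun i => (g i).2
  refine ⟨n, fun i => Finsupp.single 0 (f i), K, hK, ?_⟩
  rw [← h]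
  refine Finset.sum_congr rfl fun i _ => ?_
  rw [actLP_single_zero, hg]

lemma upper_mem_simpleSpan {d : ℕ} (N : Matrix (Fin d) (Fin d) ℤ) (hN : N.det ≠ 0)
    (b : Fin d → ℤ) :
    (fun m : Fin d → ℤ => if ∀ k, b k ≤ (N.mulVec m) k then (1 : ℂ) else 0) ∈ simpleSpan d := by
  set R : Matrix (Fin d) (Fin d) ℝ := N.map (Int.cast : ℤ → ℝ) with hR
  have hdet : R.det = (N.det : ℝ) := by
    rw [hR]
    exact ((Int.castRingHom ℝ).map_det N).symm
  have hadj : R.adjugate = N.adjugate.map (Int.cast : ℤ → ℝ) := by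
    rw [hR]
    exact ((Int.castRingHom ℝ).map_adjugate N).symm
  have hD : (N.det : ℝ) ≠ 0 := by exact_mod_cast hN
  have hRu : IsUnit R.det := by rw [hdet]; exact hD.isUnit
  set W : Matrix (Fin d) (Fin d) ℤ := N.det • N.adjugate.transpose with hW
  have hsum : ∀ lam : Fin d → ℝ,
      R.mulVec (∑ i, lam i • toR d (W i)) = ((N.det : ℝ) * N.det) • lam := by
    intro lam
    have : ∑ i, lam i • toR d (W i) = ((N.det : ℝ) • R.adjugate).mulVec lam := by
      ext j
      simp only [Finset.sum_apply, Pi.smul_apply, toR, smul_eq_mul, Matrix.mulVec, dotProduct,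
        hadj, hW, Matrix.smul_apply, Matrix.transpose_apply, Matrix.map_apply]
      push_cast
      exact Finset.sum_congr rfl fun i _ => by ring
    rw [this, Matrix.mulVec_mulVec, Matrix.mul_smul, Matrix.mul_adjugate, hdet, smul_smul,
      Matrix.smul_mulVec, Matrix.one_mulVec]
  set v : Fin d → ℝ := R⁻¹.mulVec (toR d b) with hv
  have hRv : R.mulVec v = toR d b := by
    rw [hv, Matrix.mulVec_mulVec, Matrix.mul_nonsing_inv _ hRu, Matrix.one_mulVec]
  have hRm : ∀ m, R.mulVec (toR d m) = toR d (N.mulVec m) := by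
    intro m
    ext k
    simp [hR, Matrix.mulVec, dotProduct, toR]
  have hinj : Function.Injective R.mulVec := Matrix.mulVec_injective_of_isUnit
    ((Matrix.isUnit_iff_isUnit_det R).2 hRu)
  apply Submodule.subset_span
  refine ⟨coneSet d d v W, ⟨v, W, ?_, rfl⟩, ?_⟩
  · have hWd : (W.map (Int.cast : ℤ → ℝ)).det ≠ 0 := by
      have h1 : (W.map (Int.cast : ℤ → ℝ)).det = (W.det : ℝ) :=
        ((Int.castRingHom ℝ).map_det W).symm
      rw [h1, hW, Matrix.det_smul, Matrix.det_transpose, Matrix.det_adjugate]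
      exact_mod_cast mul_ne_zero (pow_ne_zero _ hN) (pow_ne_zero _ hN)
    exact Matrix.linearIndependent_rows_of_det_ne_zero hWd
  · ext m
    unfold genSeries
    congr 1
    apply propext
    have hpos : (0 : ℝ) < (N.det : ℝ) * N.det := mul_self_pos.2 hD
    constructor
    · intro h
      refine ⟨fun i => ((N.mulVec m i : ℝ) - b i) / (N.det * N.det), fun i => ?_, ?_⟩
      · refine div_nonneg (sub_nonneg.2 ?_) hpos.le
        exact_mod_cast h i
      · apply hinj
        rw [Matrix.mulVec_add, hsum, hRv, hRm]
        ext k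
        simp only [toR, Pi.add_apply, Pi.smul_apply, smul_eq_mul]
        rw [mul_div_cancel₀ _ hpos.ne']
        ring
    · rintro ⟨lam, h0, h⟩ k
      have h1 := congrFun (congrArg R.mulVec h) k
      rw [Matrix.mulVec_add, hsum, hRv, hRm] at h1
      simp only [toR, Pi.add_apply, Pi.smul_apply, smul_eq_mul] at h1
      have := mul_nonneg hpos.le (h0 k)
      have h2 : (b k : ℝ) ≤ (N.mulVec m k : ℝ) := by linarith
      exact_mod_cast h2

/-- Indicator functions of rays in `ℤ`. -/
def rayIndicators : Set (ℤ → ℂ) :=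
  {g | ∃ s b : ℤ, s ≠ 0 ∧ g = fun y => if b ≤ s * y then 1 else 0}

lemma prod_mem_simpleSpan {d : ℕ} (N : Matrix (Fin d) (Fin d) ℤ) (hN : N.det ≠ 0)
    (f : Fin d → ℤ → ℂ) (hf : ∀ k, f k ∈ Submodule.span ℂ rayIndicators) :
    (fun m : Fin d → ℤ => ∏ k, f k ((N.mulVec m) k)) ∈ simpleSpan d := by
  set Φ : MultilinearMap ℂ (fun _ : Fin d => ℤ → ℂ) ((Fin d → ℤ) → ℂ) :=
    (MultilinearMap.mkPiAlgebra ℂ (Fin d) ((Fin d → ℤ) → ℂ)).compLinearMap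
      (fun k => LinearMap.funLeft ℂ ℂ (fun m : Fin d → ℤ => (N.mulVec m) k)) with hΦ
  have hΦa : ∀ f, Φ f = fun m : Fin d → ℤ => ∏ k, f k ((N.mulVec m) k) := by
    intro f
    ext m
    simp [hΦ, LinearMap.funLeft_apply]
  rw [← hΦa]
  suffices H : ∀ (s : Finset (Fin d)) (f : Fin d → ℤ → ℂ),
      (∀ k ∈ s, f k ∈ Submodule.span ℂ rayIndicators) → (∀ k ∉ s, f k ∈ rayIndicators) →
      Φ f ∈ simpleSpan d from
    H Finset.univ f (fun k _ => hf k) (fun k hk => absurd (Finset.mem_univ k) hk)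
  intro s
  induction s using Finset.induction_on with
  | empty =>
    intro f _ h
    choose a b ha hfab using fun k => h k (Finset.notMem_empty k)
    have hdet : (Matrix.diagonal a * N).det ≠ 0 := by
      rw [Matrix.det_mul, Matrix.det_diagonal]
      exact mul_ne_zero (Finset.prod_ne_zero_iff.2 fun k _ => ha k) hN
    convert upper_mem_simpleSpan _ hdet b using 1
    rw [hΦa]
    ext m
    simp only [hfab, ← Matrix.mulVec_mulVec, Matrix.mulVec_diagonal]
    rw [Finset.prod_ite_zero]
    simp
  | insert k s hk ih =>
    intro f h1 h2
    have hle : Submodule.span ℂ rayIndicators ≤ (simpleSpan d).comap (Φ.toLinearMap f k) := by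
      rw [Submodule.span_le]
      intro g hg
      simp only [Submodule.comap_coe, Set.mem_preimage, MultilinearMap.toLinearMap_apply,
        SetLike.mem_coe]
      apply ih
      · intro i hi
        have : i ≠ k := by rintro rfl; exact hk hi
        rw [Function.update_of_ne this]
        exact h1 i (Finset.mem_insert_of_mem hi)
      · intro i hi
        by_cases hik : i = k
        · subst hik
          simpa using hg
        · rw [Function.update_of_ne hik]
          exact h2 i (by simp [hik, hi])
    have := hle (h1 k (Finset.mem_insert_self k s))
    simpa using this

lemma coordSet_mem_span {T : Set ℝ} (hT : IsCoordSet T) (b : ℝ) :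
    (fun y : ℤ => if (y : ℝ) - b ∈ T then (1 : ℂ) else 0) ∈
      Submodule.span ℂ rayIndicators := by
  have hup : ∀ a : ℤ, (fun y : ℤ => if a ≤ y then (1 : ℂ) else 0) ∈
      Submodule.span ℂ rayIndicators :=
    fun a => Submodule.subset_span ⟨1, a, one_ne_zero, by simp⟩
  rcases hT with rfl | rfl | rfl
  · have hdown : (fun y : ℤ => if 1 ≤ -1 * y then (1 : ℂ) else 0) ∈
        Submodule.span ℂ rayIndicators :=
      Submodule.subset_span ⟨-1, 1, by norm_num, rfl⟩
    convert Submodule.add_mem _ (hup 0) hdown using 1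
    ext y
    by_cases hy : 0 ≤ y
    · have : ¬ (1 ≤ -1 * y) := by omega
      simp only [Set.mem_univ, if_true, Pi.add_apply, if_pos hy, if_neg this, add_zero]
    · have : 1 ≤ -1 * y := by omega
      simp only [Set.mem_univ, if_true, Pi.add_apply, if_neg hy, if_pos this, zero_add]
  · convert hup ⌈b⌉ using 1
    ext y
    simp [Int.ceil_le]
  · convert Submodule.sub_mem _ (hup ⌈b⌉) (hup (⌊b⌋ + 1)) using 1
    ext y
    simp only [Set.mem_singleton_iff, Pi.sub_apply, Int.ceil_le, Int.add_one_le_iff, Int.floor_lt]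
    rcases lt_trichotomy b y with h | h | h
    · simp [h, h.le, sub_eq_zero, h.ne']
    · simp [h]
    · simp [h.not_ge, h.not_gt, sub_eq_zero, h.ne]

/-- The integer-point generating series of any rational polyhedral cone
`K = v + ℝ_{≥0}w₁ + ⋯ + ℝ_{≥0}w_n` (with `wᵢ ∈ ℤ^d`) lies in the module `PL` of polyhedral
Laurent series: it is a finite `ℂ[x₁^{±1},…,x_d^{±1}]`-linear combination of the series of
simple rational cones. -/
theorem statement2 (d n : ℕ) (v : Fin d → ℝ) (w : Fin n → Fin d → ℤ) :
    MemPL d (genSeries d (coneSet d n v w)) := by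
  apply memPL_of_mem_simpleSpan
  obtain ⟨F, hF⟩ := exists_coneSet_eq_dualCone d n v w
  have := dualCone_induction
    (fun X => (fun m : Fin d → ℤ => if toR d m - v ∈ X then (1 : ℂ) else 0) ∈ simpleSpan d)
    ?_ ?_ F
  · convert this using 1
    ext m
    simp only [genSeries, hF]
  · intro X Y hX hY hXY
    convert Submodule.sub_mem _ (Submodule.add_mem _ hX hY) hXY using 1
    ext m
    by_cases h1 : toR d m - v ∈ X <;> by_cases h2 : toR d m - v ∈ Y <;> simp [h1, h2]
  · intro N T hN hT
    convert prod_mem_simpleSpan N hN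
      (fun k (y : ℤ) => if (y : ℝ) - evalAt v (N k) ∈ T k then (1 : ℂ) else 0)
      (fun k => coordSet_mem_span (hT k) _) using 1
    ext m
    rw [Finset.prod_ite_zero]
    simp only [cell, Set.mem_ofPred_eq, evalAt_sub, evalAt_toR, Finset.mem_univ, forall_const,
      Finset.prod_const_one]
    rfl

end
end

section
/- For every S in the module PL of polyhedral Laurent series there exists a nonzero Laurent polynomial g ∈ ℂ[x_1^{±1},…,x_d^{±1}] such that g·S is the series of a Laurent polynomial f; moreover, the rational function f/g ∈ ℂ(x_1,…,x_d) does not depend on the choice of such g (if g·S = f and g'·S = f' with g, g' nonzero Laurent polynomials and f, f' Laurent polynomials, then f/g = f'/g' in ℂ(x_1,…,x_d)). -/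
open scoped BigOperators Classical

noncomputable section

section LaurentAction

open AddMonoidAlgebra

variable {d : ℕ}

/-- Translation of formal Laurent series by integer vectors, as a monoid homomorphism. -/
def shiftHom (d : ℕ) :
    Multiplicative (Fin d → ℤ) →* Module.End ℂ ((Fin d → ℤ) → ℂ) where
  toFun w :=
    { toFun := fun S m => S (m - w.toAdd)
      map_add' := fun _ _ => rfl
      map_smul' := fun _ _ => rfl }
  map_one' := by ext; simp
  map_mul' u v := LinearMap.ext fun S => funext fun m => by
    simp [Module.End.mul_apply, sub_sub]

/-- The action of the Laurent polynomial ring on formal Laurent series, as an algebra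
homomorphism. -/
def actHom (d : ℕ) :
    AddMonoidAlgebra ℂ (Fin d → ℤ) →ₐ[ℂ] Module.End ℂ ((Fin d → ℤ) → ℂ) :=
  AddMonoidAlgebra.lift ℂ _ _ (shiftHom d)

theorem actHom_apply (g : AddMonoidAlgebra ℂ (Fin d → ℤ)) (S : (Fin d → ℤ) → ℂ) :
    actHom d g S = actLP d g.coeff S := by
  funext m
  simp [actHom, AddMonoidAlgebra.lift_apply, Finsupp.sum, actLP, shiftHom]

theorem actHom_one_sub_single (w : Fin d → ℤ) (S : (Fin d → ℤ) → ℂ) (m : Fin d → ℤ) :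
    actHom d (1 - single w 1) S m = S m - S (m - w) := by
  simp [actHom, shiftHom]

theorem actLP_delta (f : LaurentPoly d) : actLP d f (Pi.single 0 1) = seriesOf d f := by
  funext m
  simp only [actLP, seriesOf, Pi.single_apply, sub_eq_zero, mul_ite, mul_one, mul_zero,
    Finset.sum_ite_eq, Finsupp.mem_support_iff, ne_eq, ite_not]
  split_ifs with h <;> simp [h]

/-- Monomials as a monoid homomorphism into the field of rational functions. -/
def ratMonHom (d : ℕ) : Multiplicative (Fin d → ℤ) →* RatF d where
  toFun w := ratMon d w.toAdd
  map_one' := by simp [ratMon]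
  map_mul' u v := by
    simp only [ratMon, toAdd_mul, Pi.add_apply, ← Finset.prod_mul_distrib]
    refine Finset.prod_congr rfl fun i _ => zpow_add₀ ?_ _ _
    simp

/-- The embedding of Laurent polynomials into rational functions, as an algebra homomorphism. -/
def toRatHom (d : ℕ) : AddMonoidAlgebra ℂ (Fin d → ℤ) →ₐ[ℂ] RatF d :=
  AddMonoidAlgebra.lift ℂ _ _ (ratMonHom d)

theorem toRatHom_apply (g : AddMonoidAlgebra ℂ (Fin d → ℤ)) :
    toRatHom d g = toRat d g.coeff := by
  simp only [toRatHom, AddMonoidAlgebra.lift_apply', Finsupp.sum, toRat, ratMonHom]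
  rfl

theorem ratMon_natCast (e : Fin d →₀ ℕ) :
    ratMon d (fun i => (e i : ℤ)) =
      algebraMap (MvPolynomial (Fin d) ℂ) (RatF d) (MvPolynomial.monomial e 1) := by
  simp [ratMon, MvPolynomial.monomial_eq, Finsupp.prod_fintype]

theorem toRat_ne_zero {g : LaurentPoly d} (hg : g ≠ 0) : toRat d g ≠ 0 := by
  intro h0
  obtain ⟨b, hb⟩ := g.support.bddBelow
  let e : (Fin d → ℤ) → (Fin d →₀ ℕ) :=
    fun w => Finsupp.equivFunOnFinite.symm fun i => (w i - b i).toNat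
  have he : ∀ w ∈ g.support, (fun i => (e w i : ℤ)) = w + -b := by
    intro w hw
    funext i
    have : b i ≤ w i := hb hw i
    simp [e]
    omega
  have hp : algebraMap (MvPolynomial (Fin d) ℂ) (RatF d)
      (∑ w ∈ g.support, MvPolynomial.monomial (e w) (g w)) = toRat d g * ratMon d (-b) := by
    rw [map_sum, toRat, Finset.sum_mul]
    refine Finset.sum_congr rfl fun w hw => ?_
    rw [mul_assoc, show ratMon d w * ratMon d (-b) = ratMon d (w + -b) from
      ((ratMonHom d).map_mul (.ofAdd w) (.ofAdd (-b))).symm, ← he w hw, ratMon_natCast, ← map_mul,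
      MvPolynomial.C_mul_monomial, mul_one]
  rw [h0, zero_mul, map_eq_zero_iff _ (IsFractionRing.injective _ _)] at hp
  obtain ⟨w, hw⟩ := Finsupp.support_nonempty_iff.mpr hg
  have hc := congrArg (MvPolynomial.coeff (e w)) hp
  rw [MvPolynomial.coeff_sum, Finset.sum_eq_single_of_mem w hw] at hc
  · exact Finsupp.mem_support_iff.mp hw (by simpa using hc)
  · intro u hu huw
    rw [MvPolynomial.coeff_monomial, if_neg]
    intro h
    apply huw
    exact add_right_cancel ((he u hu).symm.trans
      ((congrArg (fun (f : Fin d →₀ ℕ) i => (f i : ℤ)) h).trans (he w hw)))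

theorem laurent_mul_ne_zero {g h : AddMonoidAlgebra ℂ (Fin d → ℤ)} (hg : g ≠ 0) (hh : h ≠ 0) :
    g * h ≠ 0 := by
  have key : ∀ {g : AddMonoidAlgebra ℂ (Fin d → ℤ)}, g ≠ 0 → toRatHom d g ≠ 0 := fun hg => by
    rw [toRatHom_apply]
    exact toRat_ne_zero (by simpa using hg)
  intro h0
  apply mul_ne_zero (key hg) (key hh)
  rw [← map_mul, h0, map_zero]

/-- A formal Laurent series is rational if some nonzero Laurent polynomial multiplies it into a
Laurent polynomial. -/
def IsRationalSeries (S : (Fin d → ℤ) → ℂ) : Prop :=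
  ∃ g : AddMonoidAlgebra ℂ (Fin d → ℤ), g ≠ 0 ∧
    ∃ f : AddMonoidAlgebra ℂ (Fin d → ℤ), actHom d g S = actHom d f (Pi.single 0 1)

theorem isRationalSeries_zero : IsRationalSeries (0 : (Fin d → ℤ) → ℂ) :=
  ⟨1, one_ne_zero, 0, by simp⟩

theorem actHom_comm (g h : AddMonoidAlgebra ℂ (Fin d → ℤ)) (S : (Fin d → ℤ) → ℂ) :
    actHom d g (actHom d h S) = actHom d h (actHom d g S) := by
  rw [← Module.End.mul_apply, ← map_mul, mul_comm, map_mul, Module.End.mul_apply]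

theorem IsRationalSeries.add {S T : (Fin d → ℤ) → ℂ} (hS : IsRationalSeries S)
    (hT : IsRationalSeries T) : IsRationalSeries (S + T) := by
  obtain ⟨g, hg, f, hf⟩ := hS
  obtain ⟨g', hg', f', hf'⟩ := hT
  refine ⟨g' * g, laurent_mul_ne_zero hg' hg, g' * f + g * f', ?_⟩
  rw [map_add (actHom d (g' * g)), map_add (actHom d), LinearMap.add_apply]
  simp only [map_mul, Module.End.mul_apply]
  rw [hf, actHom_comm g' g T, hf']

theorem IsRationalSeries.act {S : (Fin d → ℤ) → ℂ} (hS : IsRationalSeries S)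
    (h : AddMonoidAlgebra ℂ (Fin d → ℤ)) : IsRationalSeries (actHom d h S) := by
  obtain ⟨g, hg, f, hf⟩ := hS
  refine ⟨g, hg, h * f, ?_⟩
  rw [actHom_comm, hf, map_mul, Module.End.mul_apply]

theorem actHom_prod_one_sub_single {n : ℕ} (w : Fin n → Fin d → ℤ)
    (c : Fin n → (Fin d → ℤ) → ℝ)
    (hc : ∀ i j m, c i (m - w j) = c i m - if i = j then 1 else 0) (J : Finset (Fin n)) :
    actHom d (∏ j ∈ J, (1 - single (w j) 1)) (fun m => if ∀ i, 0 ≤ c i m then 1 else 0) =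
      fun m => if ∀ i, 0 ≤ c i m ∧ (i ∈ J → c i m < 1) then 1 else 0 := by
  induction J using Finset.induction_on with
  | empty => simp
  | insert j J hj ih =>
    rw [Finset.prod_insert hj, map_mul, Module.End.mul_apply, ih]
    funext m
    rw [actHom_one_sub_single]
    have h1 : (∀ i, 0 ≤ c i m ∧ (i ∈ insert j J → c i m < 1)) ↔
        (∀ i, 0 ≤ c i m ∧ (i ∈ J → c i m < 1)) ∧ c j m < 1 := by
      constructor
      · exact fun h => ⟨fun i => ⟨(h i).1, fun hi => (h i).2 (Finset.mem_insert_of_mem hi)⟩,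
          (h j).2 (Finset.mem_insert_self _ _)⟩
      · rintro ⟨h, hj1⟩ i
        refine ⟨(h i).1, fun hi => ?_⟩
        rcases Finset.mem_insert.mp hi with rfl | hi
        exacts [hj1, (h i).2 hi]
    have h2 : (∀ i, 0 ≤ c i (m - w j) ∧ (i ∈ J → c i (m - w j) < 1)) ↔
        (∀ i, 0 ≤ c i m ∧ (i ∈ J → c i m < 1)) ∧ 1 ≤ c j m := by
      simp only [hc]
      constructor
      · intro h
        have hj1 : 1 ≤ c j m := by simpa using (h j).1
        refine ⟨fun i => ?_, hj1⟩
        by_cases hij : i = j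
        · subst hij
          exact ⟨by linarith, fun hi => absurd hi hj⟩
        · simpa [hij] using h i
      · rintro ⟨h, hj1⟩ i
        by_cases hij : i = j
        · subst hij
          exact ⟨by simpa using hj1, fun hi => absurd hi hj⟩
        · simpa [hij] using h i
    simp only [h1, h2]
    by_cases hP : ∀ i, 0 ≤ c i m ∧ (i ∈ J → c i m < 1)
    · rcases lt_or_ge (c j m) 1 with h | h
      · simp [hP, h, not_le.mpr h]
      · simp [hP, h, not_lt.mpr h]
    · simp [hP]

theorem finite_lattice_parSet (v : Fin d → ℝ) (w : Fin d → Fin d → ℤ) :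
    {m : Fin d → ℤ | toR d m ∈ parSet d v w}.Finite := by
  let B : Fin d → ℝ := fun k => |v k| + ∑ i, |(w i k : ℝ)|
  refine (Set.finite_Icc (fun k => -⌈B k⌉) (fun k => ⌈B k⌉)).subset ?_
  rintro m ⟨lam, hlam, hm⟩
  have hB : ∀ k, |(m k : ℝ)| ≤ B k := by
    intro k
    have hk : (m k : ℝ) = v k + ∑ i, lam i * (w i k : ℝ) := by
      simpa [toR] using congrFun hm k
    rw [hk]
    refine (abs_add_le _ _).trans (add_le_add_right ((Finset.abs_sum_le_sum_abs _ _).trans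
      (Finset.sum_le_sum fun i _ => ?_)) _)
    rw [abs_mul, abs_of_nonneg (hlam i).1]
    exact mul_le_of_le_one_left (abs_nonneg _) (hlam i).2.le
  have hB' : ∀ k, |m k| ≤ ⌈B k⌉ := fun k => by
    have : ((|m k| : ℤ) : ℝ) ≤ ⌈B k⌉ := by
      rw [Int.cast_abs]
      exact (hB k).trans (Int.le_ceil _)
    exact_mod_cast this
  exact ⟨fun k => (abs_le.mp (hB' k)).1, fun k => (abs_le.mp (hB' k)).2⟩

theorem isRationalSeries_coneSet (v : Fin d → ℝ) (w : Fin d → Fin d → ℤ)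
    (hw : LinearIndependent ℝ fun i => toR d (w i)) :
    IsRationalSeries (genSeries d (coneSet d d v w)) := by
  let b := basisOfLinearIndependentOfCardEqFinrank' _ hw (by simp)
  have hb : ∀ i, b i = toR d (w i) := fun i => by simp [b]
  let c : Fin d → (Fin d → ℤ) → ℝ := fun i m => b.repr (toR d m - v) i
  have hc : ∀ i j m, c i (m - w j) = c i m - if i = j then 1 else 0 := by
    intro i j m
    have : toR d (m - w j) - v = (toR d m - v) - b j := by
      rw [hb]
      funext k
      simp only [toR, Pi.sub_apply, Int.cast_sub]
      ring
    simp only [c, this, map_sub _ (toR d m - v), Finsupp.sub_apply, Module.Basis.repr_self,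
      Finsupp.single_apply, eq_comm]
  have hrepr : ∀ (m : Fin d → ℤ) (lam : Fin d → ℝ),
      toR d m = v + ∑ i, lam i • toR d (w i) ↔ ∀ i, lam i = c i m := by
    intro m lam
    simp only [← hb, c]
    rw [← sub_eq_iff_eq_add', ← b.repr.injective.eq_iff, Finsupp.ext_iff]
    simp [Finsupp.single_apply, eq_comm]
  have hcone : genSeries d (coneSet d d v w) = fun m => if ∀ i, 0 ≤ c i m then 1 else 0 := by
    funext m
    simp only [genSeries, coneSet, Set.mem_ofPred_eq, hrepr]
    refine if_congr ⟨?_, fun h => ⟨fun i => c i m, h, fun _ => rfl⟩⟩ rfl rfl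
    rintro ⟨lam, h0, h⟩ i
    exact h i ▸ h0 i
  have hfin : {m | ∀ i, 0 ≤ c i m ∧ (i ∈ Finset.univ → c i m < 1)}.Finite := by
    refine (finite_lattice_parSet v w).subset fun m hm => ?_
    exact ⟨fun i => c i m, fun i => ⟨(hm i).1, (hm i).2 (Finset.mem_univ i)⟩,
      (hrepr m _).mpr fun _ => rfl⟩
  refine ⟨∏ j, (1 - single (w j) 1), ?_, ?_⟩
  · refine Finset.prod_induction _ (· ≠ 0) (fun _ _ => laurent_mul_ne_zero) one_ne_zero ?_
    intro j _ h
    apply hw.ne_zero j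
    have h0 : (0 : Fin d → ℤ) = w j :=
      (single_left_inj (one_ne_zero (α := ℂ))).mp (sub_eq_zero.mp h)
    funext k
    simp [toR, ← h0]
  · let f : LaurentPoly d := Finsupp.onFinset hfin.toFinset
      (fun m => if ∀ i, 0 ≤ c i m ∧ (i ∈ Finset.univ → c i m < 1) then 1 else 0)
      (fun m hm => by
        rw [Set.Finite.mem_toFinset]
        exact of_not_not fun h => hm (if_neg h))
    refine ⟨.ofCoeff f, ?_⟩
    rw [hcone, actHom_prod_one_sub_single w c hc, actHom_apply, actLP_delta]
    rfl

theorem MemPL.isRationalSeries {S : (Fin d → ℤ) → ℂ} (hS : MemPL d S) : IsRationalSeries S := by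
  obtain ⟨n, g, K, hK, rfl⟩ := hS
  refine Finset.sum_induction _ IsRationalSeries (fun _ _ => IsRationalSeries.add)
    isRationalSeries_zero fun i _ => ?_
  obtain ⟨v, w, hw, h⟩ := hK i
  rw [h]
  simpa only [actHom_apply] using (isRationalSeries_coneSet v w hw).act (.ofCoeff (g i))

end LaurentAction

/-- For every `S ∈ PL` there is a nonzero Laurent polynomial `g` with
`g·S` the series of a Laurent polynomial `f`, and the rational function `f/g` is
independent of the choice. -/
theorem statement3 (d : ℕ) (S : (Fin d → ℤ) → ℂ) (hS : MemPL d S) :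
    (∃ g : LaurentPoly d, g ≠ 0 ∧ ∃ f : LaurentPoly d, actLP d g S = seriesOf d f) ∧
    (∀ g g' f f' : LaurentPoly d, g ≠ 0 → g' ≠ 0 →
      actLP d g S = seriesOf d f → actLP d g' S = seriesOf d f' →
      toRat d f / toRat d g = toRat d f' / toRat d g') := by
  constructor
  · obtain ⟨g, hg, f, hf⟩ := hS.isRationalSeries
    refine ⟨g.coeff, by simpa using hg, f.coeff, ?_⟩
    rw [← actLP_delta, ← actHom_apply, ← actHom_apply, hf]
  · intro g g' f f' hg hg' hf hf'
    let a : LaurentPoly d → AddMonoidAlgebra ℂ (Fin d → ℤ) := .ofCoeff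
    have hact : ∀ (h : LaurentPoly d) T, actHom d (a h) T = actLP d h T :=
      fun h T => actHom_apply (a h) T
    have hmul : a g' * a f = a g * a f' := by
      apply AddMonoidAlgebra.coeff_injective
      apply DFunLike.coe_injective
      change seriesOf d _ = seriesOf d _
      rw [← actLP_delta, ← actLP_delta, ← actHom_apply, ← actHom_apply, map_mul, map_mul,
        Module.End.mul_apply, Module.End.mul_apply, hact f, hact f', actLP_delta, actLP_delta,
        ← hf, ← hf', ← hact, ← hact, actHom_comm]
    have hrat := congrArg (toRatHom d) hmul
    simp only [map_mul, toRatHom_apply, a] at hrat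
    rw [div_eq_div_iff (toRat_ne_zero hg) (toRat_ne_zero hg')]
    linear_combination hrat

end
end

section
/- Let S ∈ PL and suppose there is a nonzero w ∈ ℤ^d with x^w·S = S. Then φ(S) = 0 in ℂ(x_1,…,x_d). In particular, if K ⊆ ℝ^d is a rational polyhedral cone that is not strictly convex, i.e., w + K = K for some nonzero w ∈ ℤ^d, then φ(S_K) = 0. -/
open scoped BigOperators Classical

noncomputable section

namespace PolyhedralSeries

/-! ### Monomials in the field of rational functions -/

lemma ratMon_ne_one {d : ℕ} {w : Fin d → ℤ} (hw : w ≠ 0) : ratMon d w ≠ 1 := by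
  intro h
  apply hw
  set a : Fin d → RatF d := fun i =>
    algebraMap (MvPolynomial (Fin d) ℂ) (RatF d) (MvPolynomial.X i) with ha
  have ha0 : ∀ i, a i ≠ 0 := fun i => by
    simp [ha, MvPolynomial.X_ne_zero]
  have key : ∏ i, a i ^ (w i).toNat = ∏ i, a i ^ (-w i).toNat := by
    have h1 : ∏ i, a i ^ (w i).toNat = (∏ i, a i ^ (w i)) * ∏ i, a i ^ (-w i).toNat := by
      rw [← Finset.prod_mul_distrib]
      refine Finset.prod_congr rfl fun i _ => ?_
      rw [← zpow_natCast, ← zpow_natCast, ← zpow_add₀ (ha0 i)]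
      congr 1
      omega
    have h2 : ∏ i, a i ^ (w i) = 1 := h
    rw [h1, h2, one_mul]
  have key2 : ∏ i, (MvPolynomial.X i : MvPolynomial (Fin d) ℂ) ^ (w i).toNat =
      ∏ i, (MvPolynomial.X i : MvPolynomial (Fin d) ℂ) ^ (-w i).toNat := by
    apply IsFractionRing.injective (MvPolynomial (Fin d) ℂ) (RatF d)
    simpa only [map_prod, map_pow] using key
  have hmon : ∀ p : Fin d → ℕ, ∏ i, (MvPolynomial.X i : MvPolynomial (Fin d) ℂ) ^ p i =
      MvPolynomial.monomial (Finsupp.equivFunOnFinite.symm p) 1 := fun p => by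
    rw [MvPolynomial.monomial_eq, Finsupp.prod_fintype _ _ (fun i => pow_zero _)]
    simp
  rw [hmon, hmon] at key2
  have h3 := MvPolynomial.monomial_left_injective (R := ℂ) one_ne_zero key2
  funext i
  have h4 := DFunLike.congr_fun h3 i
  simp only [Finsupp.equivFunOnFinite_symm_apply_apply] at h4
  simp only [Pi.zero_apply]
  omega

lemma toRat_single_one {d : ℕ} (w : Fin d → ℤ) :
    toRat d (Finsupp.single w (1 : ℂ)) = ratMon d w := by
  unfold toRat
  simp [Finsupp.support_single]

lemma actLP_single_apply {d : ℕ} (w : Fin d → ℤ) (a : ℂ) (S : (Fin d → ℤ) → ℂ) (m : Fin d → ℤ) :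
    actLP d (Finsupp.single w a) S m = a * S (m - w) := by
  have h : actLP d (Finsupp.single w a) S m =
      (Finsupp.single w a).sum fun u c => c * S (m - u) := rfl
  rw [h, Finsupp.sum_single_index (zero_mul _)]

lemma actLP_neg {d : ℕ} (g : LaurentPoly d) (S : (Fin d → ℤ) → ℂ) :
    actLP d (-g) S = -actLP d g S := by
  funext m
  simp [actLP]

lemma phi_eq_zero_of_periodic {d : ℕ} {φ : ((Fin d → ℤ) → ℂ) → RatF d} (hφ : IsPhi d φ)
    {S : (Fin d → ℤ) → ℂ} (hS : MemPL d S) {w : Fin d → ℤ} (hw : w ≠ 0)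
    (h : actLP d (Finsupp.single w (1 : ℂ)) S = S) : φ S = 0 := by
  have h1 := hφ.2.1 (Finsupp.single w 1) S hS
  rw [h, toRat_single_one] at h1
  by_contra h0
  exact ratMon_ne_one hw (mul_right_cancel₀ h0 (by rw [one_mul, ← h1]))

/-! ### Closure properties of polyhedral Laurent series -/

lemma memPL_zero (d : ℕ) : MemPL d 0 :=
  ⟨0, Fin.elim0, Fin.elim0, fun i => i.elim0, by simp⟩

lemma MemPL.add {d : ℕ} {S T : (Fin d → ℤ) → ℂ} (hS : MemPL d S) (hT : MemPL d T) :
    MemPL d (S + T) := by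
  obtain ⟨n, g, K, hK, rfl⟩ := hS
  obtain ⟨n', g', K', hK', rfl⟩ := hT
  refine ⟨n + n', Fin.append g g', Fin.append K K', fun i => ?_, ?_⟩
  · induction i using Fin.addCases with
    | left i => simpa using hK i
    | right i => simpa using hK' i
  · simp [Fin.sum_univ_add]

lemma MemPL.neg {d : ℕ} {S : (Fin d → ℤ) → ℂ} (hS : MemPL d S) : MemPL d (-S) := by
  obtain ⟨n, g, K, hK, rfl⟩ := hS
  refine ⟨n, fun i => -g i, K, hK, ?_⟩
  simp [actLP_neg]

lemma MemPL.sub {d : ℕ} {S T : (Fin d → ℤ) → ℂ} (hS : MemPL d S) (hT : MemPL d T) :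
    MemPL d (S - T) := by
  rw [sub_eq_add_neg]
  exact MemPL.add hS (MemPL.neg hT)

lemma memPL_of_isSimpleCone {d : ℕ} {K : Set (Fin d → ℝ)} (hK : IsSimpleCone d K) :
    MemPL d (genSeries d K) := by
  refine ⟨1, fun _ => Finsupp.single 0 1, fun _ => K, fun _ => hK, ?_⟩
  funext m
  simp [actLP_single_apply]

/-! ### Simplicial cones with some facets removed and some generators discarded -/

section Simplicial

variable {d : ℕ} (b : Module.Basis (Fin d) ℝ (Fin d → ℝ)) (z : Fin d → Fin d → ℤ)

lemma memPL_coord_ge (hb : ∀ k, b k = toR d (z k)) (v : Fin d → ℝ) (e : Fin d → ℝ) :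
    MemPL d (genSeries d {y | ∀ k, e k ≤ b.repr (y - v) k}) := by
  apply memPL_of_isSimpleCone
  refine ⟨v + ∑ k, e k • b k, z, ?_, ?_⟩
  · simpa only [← hb] using b.linearIndependent
  · ext y
    simp only [coneSet, Set.mem_ofPred_eq, ← hb]
    constructor
    · intro h
      refine ⟨fun k => b.repr (y - v) k - e k, fun k => sub_nonneg.2 (h k), ?_⟩
      simp only [sub_smul, Finset.sum_sub_distrib, b.sum_repr]
      abel
    · rintro ⟨lam, hlam, rfl⟩ k
      have : v + ∑ k, e k • b k + ∑ i, lam i • b i - v = ∑ i, (e i + lam i) • b i := by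
        simp only [add_smul, Finset.sum_add_distrib]
        abel
      rw [this, b.repr_sum_self]
      linarith [hlam k]

lemma exists_intCast_mul_coord (hb : ∀ k, b k = toR d (z k)) :
    ∃ D : ℤ, D ≠ 0 ∧ ∀ (m : Fin d → ℤ) (k : Fin d), ∃ j : ℤ, (D : ℝ) * b.repr (toR d m) k = j := by
  set M : Matrix (Fin d) (Fin d) ℤ := Matrix.of z with hM
  set R : Matrix (Fin d) (Fin d) ℝ := M.map (Int.cast : ℤ → ℝ) with hR
  have hRrow : R.row = b := by
    funext k
    rw [hb]
    rfl
  have hdet : (M.det : ℝ) = R.det := by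
    simpa using (Int.castRingHom ℝ).map_det M
  have hunit : IsUnit R := by
    rw [← Matrix.linearIndependent_rows_iff_isUnit, hRrow]
    exact b.linearIndependent
  refine ⟨M.det, fun h0 => ?_, fun m k => ?_⟩
  · rw [Matrix.isUnit_iff_isUnit_det, ← hdet, h0] at hunit
    simp at hunit
  · refine ⟨Matrix.vecMul m M.adjugate k, ?_⟩
    have h1 : Matrix.vecMul (b.repr (toR d m)) R = toR d m := by
      conv_rhs => rw [← b.sum_repr (toR d m)]
      rw [Matrix.vecMul_eq_sum]
      exact Finset.sum_congr rfl fun i _ => by rw [← hRrow]; rfl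
    have h2 : Matrix.vecMul (toR d m) R.adjugate = R.det • (b.repr (toR d m) : Fin d → ℝ) := by
      conv_lhs => rw [← h1]
      rw [Matrix.vecMul_vecMul, Matrix.mul_adjugate, Matrix.vecMul_smul, Matrix.vecMul_one]
    have h3 : R.adjugate = M.adjugate.map (Int.cast : ℤ → ℝ) := by
      simpa using ((Int.castRingHom ℝ).map_adjugate M).symm
    have h4 := congrFun h2 k
    rw [h3] at h4
    rw [hdet]
    simp only [Pi.smul_apply, smul_eq_mul] at h4
    rw [← h4]
    simp [Matrix.vecMul, dotProduct, toR]

lemma exists_pos_le_coord (hb : ∀ k, b k = toR d (z k)) (v : Fin d → ℝ) (k : Fin d) :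
    ∃ ε : ℝ, 0 < ε ∧ ∀ m : Fin d → ℤ,
      0 < b.repr (toR d m - v) k → ε ≤ b.repr (toR d m - v) k := by
  obtain ⟨D, hD, h⟩ := exists_intCast_mul_coord b z hb
  wlog hpos : 0 < D generalizing D
  · refine this (-D) (neg_ne_zero.2 hD) (fun m k => ?_) (by omega)
    obtain ⟨j, hj⟩ := h m k
    exact ⟨-j, by push_cast; linarith⟩
  have hD' : (0 : ℝ) < D := by exact_mod_cast hpos
  set α : ℝ := D * b.repr v k with hα
  refine ⟨(⌊α⌋ + 1 - α) / D, div_pos (by linarith [Int.lt_floor_add_one α]) hD', fun m hm => ?_⟩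
  obtain ⟨j, hj⟩ := h m k
  have h1 : (D : ℝ) * b.repr (toR d m - v) k = j - α := by
    rw [map_sub, Finsupp.sub_apply, mul_sub, hj]
  have h2 : (0 : ℝ) < j - α := h1 ▸ mul_pos hD' hm
  have h3 : ⌊α⌋ + 1 ≤ j := Int.floor_lt.2 (by linarith)
  have h4 : ((⌊α⌋ : ℝ) + 1) ≤ j := by exact_mod_cast h3
  rw [div_le_iff₀ hD', mul_comm, h1]
  linarith

lemma genSeries_apply_eq_sub {d : ℕ} {A B C : Set (Fin d → ℝ)} {m : Fin d → ℤ}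
    (h : toR d m ∈ B ↔ toR d m ∈ A ∨ toR d m ∈ C) (h' : ¬(toR d m ∈ A ∧ toR d m ∈ C)) :
    genSeries d A m = genSeries d B m - genSeries d C m := by
  by_cases hA : toR d m ∈ A <;> by_cases hC : toR d m ∈ C <;> simp_all [genSeries]

lemma memPL_coord_ge_of_eq_zero (hb : ∀ k, b k = toR d (z k)) (v : Fin d → ℝ) (Z : Finset (Fin d)) :
    ∀ e : Fin d → ℝ, MemPL d (genSeries d
      {y | (∀ k ∉ Z, e k ≤ b.repr (y - v) k) ∧ ∀ k ∈ Z, b.repr (y - v) k = 0}) := by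
  induction Z using Finset.induction_on with
  | empty => intro e; simpa using memPL_coord_ge b z hb v e
  | insert k Z hk ih =>
    intro e
    obtain ⟨ε, hε, hmin⟩ := exists_pos_le_coord b z hb v k
    convert MemPL.sub (ih (Function.update e k 0)) (ih (Function.update e k ε)) using 1
    funext m
    have hsplit : ∀ t : ℝ,
        (toR d m ∈ {y | (∀ j ∉ Z, Function.update e k t j ≤ b.repr (y - v) j) ∧
          ∀ j ∈ Z, b.repr (y - v) j = 0}) ↔
        t ≤ b.repr (toR d m - v) k ∧ ((∀ j ∉ insert k Z, e j ≤ b.repr (toR d m - v) j) ∧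
          ∀ j ∈ Z, b.repr (toR d m - v) j = 0) := by
      intro t
      simp only [Set.mem_ofPred_eq, Finset.mem_insert, not_or]
      constructor
      · rintro ⟨h1, h2⟩
        refine ⟨by simpa using h1 k hk, fun j hj => ?_, h2⟩
        simpa [hj.1] using h1 j hj.2
      · rintro ⟨h0, h1, h2⟩
        refine ⟨fun j hj => ?_, h2⟩
        by_cases hjk : j = k
        · subst hjk; simpa using h0
        · simpa [hjk] using h1 j ⟨hjk, hj⟩
    have hlast : (toR d m ∈ {y | (∀ j ∉ insert k Z, e j ≤ b.repr (y - v) j) ∧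
          ∀ j ∈ insert k Z, b.repr (y - v) j = 0}) ↔
        b.repr (toR d m - v) k = 0 ∧ ((∀ j ∉ insert k Z, e j ≤ b.repr (toR d m - v) j) ∧
          ∀ j ∈ Z, b.repr (toR d m - v) j = 0) := by
      simp only [Set.mem_ofPred_eq, Finset.forall_mem_insert]
      tauto
    rw [Pi.sub_apply]
    refine genSeries_apply_eq_sub ?_ ?_ <;> rw [hlast, hsplit]
    · rw [hsplit, ← or_and_right]
      refine and_congr_left fun _ => ⟨fun h => ?_, ?_⟩
      · exact h.eq_or_lt.imp Eq.symm (hmin m)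
      · rintro (h | h)
        · exact h.ge
        · exact hε.le.trans h
    · rintro ⟨⟨h, -⟩, h', -⟩
      linarith

lemma memPL_coord_pos (hb : ∀ k, b k = toR d (z k)) (v : Fin d → ℝ) (T : Finset (Fin d)) :
    MemPL d (genSeries d
      {y | (∀ k ∈ T, 0 < b.repr (y - v) k) ∧ ∀ k ∉ T, b.repr (y - v) k = 0}) := by
  choose ε hε hmin using exists_pos_le_coord b z hb v
  convert memPL_coord_ge_of_eq_zero b z hb v Tᶜ ε using 1
  funext m
  have : (∀ k ∈ T, 0 < b.repr (toR d m - v) k) ↔ ∀ k ∈ T, ε k ≤ b.repr (toR d m - v) k :=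
    forall₂_congr fun k _ => ⟨hmin k m, (hε k).trans_le⟩
  simp only [genSeries, Set.mem_ofPred_eq, Finset.mem_compl, not_not, this]

end Simplicial

/-- The relatively open cone `v + Σ_{i ∈ I} ℝ_{>0} w_i`. -/
def openCone {d n : ℕ} (v : Fin d → ℝ) (w : Fin n → Fin d → ℤ) (I : Finset (Fin n)) :
    Set (Fin d → ℝ) :=
  {y | ∃ lam : Fin n → ℝ, (∀ i ∈ I, 0 < lam i) ∧ (∀ i ∉ I, lam i = 0) ∧
    y = v + ∑ i, lam i • toR d (w i)}

lemma toR_single {d : ℕ} (k : Fin d) : toR d (Pi.single k 1) = Pi.single k 1 := by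
  funext i
  by_cases h : i = k
  · subst h; simp [toR]
  · simp [toR, h]

lemma memPL_openCone {d n : ℕ} (v : Fin d → ℝ) (w : Fin n → Fin d → ℤ) (I : Finset (Fin n))
    (hI : LinearIndepOn ℝ (fun i => toR d (w i)) (I : Set (Fin n))) :
    MemPL d (genSeries d (openCone v w I)) := by
  set u : Fin n ⊕ Fin d → Fin d → ℤ := Sum.elim w fun k => Pi.single k 1 with hu
  have hI' : LinearIndepOn ℝ (fun i => toR d (u i)) (Sum.inl '' (I : Set (Fin n))) := by
    refine LinearIndepOn.image_of_comp (f := Sum.inl) (g := fun i => toR d (u i)) ?_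
    exact hI
  obtain ⟨B, -, hIB, hspan, hB⟩ := exists_linearIndepOn_extension hI' (Set.subset_univ _)
  have htop : ⊤ ≤ Submodule.span ℝ (Set.range fun i : B => toR d (u i)) := by
    rw [← (Pi.basisFun ℝ (Fin d)).span_eq, Submodule.span_le]
    rintro _ ⟨k, rfl⟩
    have := hspan ⟨Sum.inr k, trivial, rfl⟩
    rw [Set.image_eq_range] at this
    simpa [hu, toR_single] using this
  let b₀ : Module.Basis B ℝ (Fin d → ℝ) := Module.Basis.mk hB htop
  have hcard : Fintype.card B = d := by
    simpa using (Module.finrank_eq_card_basis b₀).symm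
  let σ : B ≃ Fin d := Fintype.equivFinOfCardEq hcard
  let b := b₀.reindex σ
  have hb : ∀ k, b k = toR d (u (σ.symm k)) := fun k => by
    rw [Module.Basis.reindex_apply]
    exact Module.Basis.mk_apply hB htop _
  let T : Finset (Fin d) :=
    Finset.univ.filter fun k => ((σ.symm k : B) : Fin n ⊕ Fin d) ∈ Sum.inl '' (I : Set (Fin n))
  convert memPL_coord_pos b (fun k => u (σ.symm k)) hb v T using 2
  -- the coefficients on `I` and the coordinates with respect to `b` agree
  have hsum : ∀ c : Fin n ⊕ Fin d → ℝ, (∀ i ∉ Sum.inl '' (I : Set (Fin n)), c i = 0) →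
      ∑ k, c (σ.symm k) • b k = ∑ i, c (Sum.inl i) • toR d (w i) := by
    intro c hc
    have h1 : ∑ k, c (σ.symm k) • b k = ∑ x : B, c x • toR d (u x) := by
      simp only [hb]
      exact Equiv.sum_comp σ.symm fun x : B => c x • toR d (u x)
    have h2 : ∑ x : B, c x • toR d (u x) = ∑ x, c x • toR d (u x) := by
      rw [← Finset.sum_subtype B.toFinset (fun x => Set.mem_toFinset) fun x => c x • toR d (u x)]
      refine Finset.sum_subset (Finset.subset_univ _) fun x _ hx => ?_
      rw [hc x fun h => hx (Set.mem_toFinset.2 (hIB h)), zero_smul]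
    have h3 : ∀ k : Fin d, c (Sum.inr k) = 0 := fun k => hc _ (by simp)
    rw [h1, h2, Fintype.sum_sum_type]
    simp [h3, hu]
  ext y
  constructor
  · rintro ⟨lam, hpos, hzero, rfl⟩
    set c : Fin n ⊕ Fin d → ℝ := Sum.elim lam 0 with hc
    have hc0 : ∀ i ∉ Sum.inl '' (I : Set (Fin n)), c i = 0 := by
      rintro (i | k) hi
      · exact hzero i fun h => hi ⟨i, h, rfl⟩
      · rfl
    have hy : v + ∑ i, lam i • toR d (w i) - v = ∑ k, c (σ.symm k) • b k := by
      rw [hsum c hc0]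
      simp [hc]
    simp only [Set.mem_ofPred_eq, hy, b.repr_sum_self, T, Finset.mem_filter, Finset.mem_univ,
      true_and]
    refine ⟨fun k hk => ?_, fun k hk => hc0 _ hk⟩
    obtain ⟨i, hi, hik⟩ := hk
    rw [← hik]
    exact hpos i hi
  · rintro ⟨hpos, hzero⟩
    set c : Fin n ⊕ Fin d → ℝ := fun x =>
      if hx : x ∈ B then b.repr (y - v) (σ ⟨x, hx⟩) else 0 with hc
    have hcσ : ∀ k, c (σ.symm k) = b.repr (y - v) k := fun k => by simp [hc]
    have hc0 : ∀ i ∉ Sum.inl '' (I : Set (Fin n)), c i = 0 := by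
      intro i hi
      by_cases hx : i ∈ B
      · simp only [hc, hx, dif_pos]
        exact hzero _ (by simpa [T] using hi)
      · simp [hc, hx]
    refine ⟨fun i => c (Sum.inl i), fun i hi => ?_, fun i hi => hc0 _ (by simpa using hi), ?_⟩
    · have hx : Sum.inl i ∈ B := hIB ⟨i, hi, rfl⟩
      simp only [hc, hx, dif_pos]
      exact hpos _ (by simpa [T] using hi)
    · rw [← hsum c hc0]
      simp only [hcσ, b.sum_repr, add_sub_cancel]

/-! ### Lexicographic decomposition of a cone into relatively open simplicial cones -/

/-- The vector of values of the functionals in `L` at `μ` is lexicographically negative. -/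
def LexNeg {n : ℕ} : List ((Fin n → ℝ) →ₗ[ℝ] ℝ) → (Fin n → ℝ) → Prop
  | [], _ => False
  | l :: L, μ => l μ < 0 ∨ (l μ = 0 ∧ LexNeg L μ)

lemma LexNeg.smul {n : ℕ} {L : List ((Fin n → ℝ) →ₗ[ℝ] ℝ)} {μ : Fin n → ℝ} (h : LexNeg L μ)
    {ε : ℝ} (hε : 0 < ε) : LexNeg L (ε • μ) := by
  induction L with
  | nil => exact h
  | cons l L ih =>
    rcases h with h | ⟨h, h'⟩
    · left
      simpa using mul_neg_of_pos_of_neg hε h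
    · right
      exact ⟨by simp [h], ih h'⟩

lemma eq_zero_of_not_lexNeg {n : ℕ} {L : List ((Fin n → ℝ) →ₗ[ℝ] ℝ)} {μ : Fin n → ℝ}
    (h : ¬LexNeg L μ) (h' : ¬LexNeg L (-μ)) : ∀ l ∈ L, l μ = 0 := by
  induction L with
  | nil => simp
  | cons l L ih =>
    simp only [LexNeg, not_or, not_and, not_lt, map_neg, neg_eq_zero, neg_nonneg] at h h'
    have h0 : l μ = 0 := le_antisymm h'.1 h.1
    exact List.forall_mem_cons.2 ⟨h0, ih (h.2 h0) (h'.2 h0)⟩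

lemma exists_lex_min {n : ℕ} (L : List ((Fin n → ℝ) →ₗ[ℝ] ℝ)) :
    ∀ {P : Set (Fin n → ℝ)}, IsCompact P → P.Nonempty → ∃ p ∈ P, ∀ q ∈ P, ¬LexNeg L (q - p) := by
  induction L with
  | nil => exact fun _ ⟨p, hp⟩ => ⟨p, hp, fun _ _ h => h⟩
  | cons l L ih =>
    intro P hP hne
    have hl : Continuous l := l.continuous_of_finiteDimensional
    obtain ⟨p₀, hp₀, hmin⟩ := hP.exists_isMinOn hne hl.continuousOn
    obtain ⟨p, ⟨hp, hpl⟩, hpmin⟩ := ih (P := P ∩ {q | l q = l p₀})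
      (hP.inter_right (isClosed_eq hl continuous_const)) ⟨p₀, hp₀, rfl⟩
    refine ⟨p, hp, fun q hq h => ?_⟩
    have hpl : l p = l p₀ := hpl
    have hq0 : l p₀ ≤ l q := hmin hq
    simp only [LexNeg, map_sub] at h
    rcases h with h | ⟨h, h'⟩
    · linarith
    · exact hpmin q ⟨hq, show l q = l p₀ by linarith⟩ h'

/-- The sum of the coordinates, followed by the coordinates themselves. -/
def lexFunctionals (n : ℕ) : List ((Fin n → ℝ) →ₗ[ℝ] ℝ) :=
  (∑ i, LinearMap.proj i) :: (List.finRange n).map LinearMap.proj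

lemma eq_zero_of_not_lexNeg_lexFunctionals {n : ℕ} {μ : Fin n → ℝ}
    (h : ¬LexNeg (lexFunctionals n) μ) (h' : ¬LexNeg (lexFunctionals n) (-μ)) : μ = 0 := by
  funext i
  exact eq_zero_of_not_lexNeg h h' (LinearMap.proj i) (by simp [lexFunctionals])

lemma exists_lex_min_of_nonneg {n : ℕ} {P : Set (Fin n → ℝ)} (hP : IsClosed P)
    (hne : P.Nonempty) (hpos : ∀ p ∈ P, ∀ i, 0 ≤ p i) :
    ∃ p ∈ P, ∀ q ∈ P, ¬LexNeg (lexFunctionals n) (q - p) := by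
  obtain ⟨p₀, hp₀⟩ := hne
  have hcomp : IsCompact (P ∩ {q | ∑ i, q i ≤ ∑ i, p₀ i}) := by
    refine (isCompact_Icc (a := (0 : Fin n → ℝ)) (b := fun _ => ∑ i, p₀ i)).of_isClosed_subset
      (hP.inter (isClosed_le (by fun_prop) continuous_const)) ?_
    rintro q ⟨hq, hq'⟩
    exact ⟨hpos q hq, fun i =>
      (Finset.single_le_sum (fun j _ => hpos q hq j) (Finset.mem_univ i)).trans hq'⟩
  obtain ⟨p, ⟨hp, hp'⟩, hmin⟩ := exists_lex_min (lexFunctionals n) hcomp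
    ⟨p₀, hp₀, le_refl (∑ i, p₀ i)⟩
  refine ⟨p, hp, fun q hq h => ?_⟩
  by_cases hq' : ∑ i, q i ≤ ∑ i, p₀ i
  · exact hmin q ⟨hq, hq'⟩ h
  · have hp' : ∑ i, p i ≤ ∑ i, p₀ i := hp'
    simp only [lexFunctionals, LexNeg, LinearMap.sum_apply, LinearMap.proj_apply, Pi.sub_apply,
      Finset.sum_sub_distrib] at h
    rcases h with h | ⟨h, -⟩ <;> linarith

/-- No linear relation between the generators that is nonnegative off `I` is
lexicographically negative, i.e. combinations with support `I` are lexicographically minimal. -/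
def IsLexSupport {d n : ℕ} (w : Fin n → Fin d → ℤ) (I : Finset (Fin n)) : Prop :=
  ∀ μ : Fin n → ℝ, ∑ i, μ i • toR d (w i) = 0 → (∀ i ∉ I, 0 ≤ μ i) →
    ¬LexNeg (lexFunctionals n) μ

lemma IsLexSupport.linearIndepOn {d n : ℕ} {w : Fin n → Fin d → ℤ} {I : Finset (Fin n)}
    (hI : IsLexSupport w I) : LinearIndepOn ℝ (fun i => toR d (w i)) (I : Set (Fin n)) := by
  rw [linearIndepOn_finset_iff]
  intro f hf i hi
  set μ : Fin n → ℝ := fun i => if i ∈ I then f i else 0 with hμ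
  have hsum : ∑ i, μ i • toR d (w i) = 0 := by
    rw [← hf]
    simp [hμ, ite_smul, Finset.sum_ite_mem]
  have h0 : μ = 0 := by
    refine eq_zero_of_not_lexNeg_lexFunctionals (hI μ hsum fun i hi => by simp [hμ, hi])
      (hI (-μ) (by simp [hsum]) fun i hi => by simp [hμ, hi])
  simpa [hμ, hi] using congrFun h0 i

lemma exists_pos_add_smul_nonneg {n : ℕ} {lam μ : Fin n → ℝ} (hlam : ∀ i, 0 ≤ lam i)
    (hμ : ∀ i, lam i = 0 → 0 ≤ μ i) : ∃ ε : ℝ, 0 < ε ∧ ∀ i, 0 ≤ lam i + ε * μ i := by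
  have h : ∀ᶠ ε : ℝ in nhdsWithin 0 (Set.Ioi 0), ∀ i, 0 ≤ lam i + ε * μ i := by
    rw [Filter.eventually_all]
    intro i
    rcases (hlam i).eq_or_lt with h0 | hpos
    · filter_upwards [self_mem_nhdsWithin] with ε hε
      rw [← h0, zero_add]
      exact mul_nonneg (le_of_lt hε) (hμ i h0.symm)
    · have hc : Filter.Tendsto (fun ε : ℝ => lam i + ε * μ i) (nhdsWithin 0 (Set.Ioi 0))
          (nhds (lam i)) := by
        have : Continuous fun ε : ℝ => lam i + ε * μ i := by fun_prop
        simpa using (this.tendsto 0).mono_left nhdsWithin_le_nhds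
      exact (hc.eventually (lt_mem_nhds hpos)).mono fun _ h => h.le
  obtain ⟨ε, h1, h2⟩ := (h.and self_mem_nhdsWithin).exists
  exact ⟨ε, h2, h1⟩

lemma exists_isLexSupport_mem_openCone {d n : ℕ} {v : Fin d → ℝ} {w : Fin n → Fin d → ℤ}
    {y : Fin d → ℝ} (hy : y ∈ coneSet d n v w) : ∃ I, IsLexSupport w I ∧ y ∈ openCone v w I := by
  set P : Set (Fin n → ℝ) :=
    {lam | (∀ i, 0 ≤ lam i) ∧ y = v + ∑ i, lam i • toR d (w i)} with hP
  have hclosed : IsClosed P := by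
    refine IsClosed.inter (?_ : IsClosed {lam : Fin n → ℝ | ∀ i, 0 ≤ lam i})
      (isClosed_eq continuous_const (by fun_prop))
    simp only [Set.ofPred_forall]
    exact isClosed_iInter fun i => isClosed_le continuous_const (continuous_apply i)
  obtain ⟨lam, ⟨hlam, hylam⟩, hmin⟩ := exists_lex_min_of_nonneg hclosed hy fun p hp => hp.1
  refine ⟨Finset.univ.filter fun i => lam i ≠ 0, fun μ hμ hμ' hneg => ?_, lam, ?_, ?_, hylam⟩
  · obtain ⟨ε, hε, hnn⟩ := exists_pos_add_smul_nonneg (μ := μ) hlam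
      fun i hi => hμ' i (by simpa using hi)
    refine hmin (lam + ε • μ) ⟨hnn, ?_⟩ (by simpa using hneg.smul hε)
    simp only [Pi.add_apply, Pi.smul_apply, smul_eq_mul, add_smul, mul_smul,
      Finset.sum_add_distrib, ← Finset.smul_sum, hμ, smul_zero, add_zero]
    exact hylam
  · intro i hi
    exact (hlam i).lt_of_ne' (by simpa using hi)
  · intro i hi
    simpa using hi

lemma IsLexSupport.eq_of_mem {d n : ℕ} {v : Fin d → ℝ} {w : Fin n → Fin d → ℤ}
    {I J : Finset (Fin n)} (hI : IsLexSupport w I) (hJ : IsLexSupport w J) {y : Fin d → ℝ}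
    (hyI : y ∈ openCone v w I) (hyJ : y ∈ openCone v w J) : I = J := by
  obtain ⟨lam, hpos, hzero, h⟩ := hyI
  obtain ⟨lam', hpos', hzero', h'⟩ := hyJ
  have hsum : ∑ i, lam i • toR d (w i) = ∑ i, lam' i • toR d (w i) :=
    add_left_cancel (h.symm.trans h')
  have hnn : ∀ i, 0 ≤ lam i := fun i => by
    by_cases hi : i ∈ I
    · exact (hpos i hi).le
    · exact (hzero i hi).ge
  have hnn' : ∀ i, 0 ≤ lam' i := fun i => by
    by_cases hi : i ∈ J
    · exact (hpos' i hi).le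
    · exact (hzero' i hi).ge
  have heq : lam' - lam = 0 := by
    refine eq_zero_of_not_lexNeg_lexFunctionals (hI _ ?_ fun i hi => ?_) (hJ _ ?_ fun i hi => ?_)
    · simp [sub_smul, hsum]
    · simpa [hzero i hi] using hnn' i
    · simp [sub_smul, hsum]
    · simpa [hzero' i hi] using hnn i
  rw [sub_eq_zero] at heq
  subst heq
  ext i
  constructor <;> intro hi <;> by_contra hi'
  · exact (hpos i hi).ne' (hzero' i hi')
  · exact (hpos' i hi).ne' (hzero i hi')

lemma openCone_subset_coneSet {d n : ℕ} (v : Fin d → ℝ) (w : Fin n → Fin d → ℤ)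
    (I : Finset (Fin n)) : openCone v w I ⊆ coneSet d n v w := by
  rintro y ⟨lam, hpos, hzero, h⟩
  refine ⟨lam, fun i => ?_, h⟩
  by_cases hi : i ∈ I
  · exact (hpos i hi).le
  · exact (hzero i hi).ge

lemma genSeries_coneSet_eq_sum {d n : ℕ} (v : Fin d → ℝ) (w : Fin n → Fin d → ℤ) :
    genSeries d (coneSet d n v w) =
      ∑ I ∈ Finset.univ.filter (IsLexSupport w), genSeries d (openCone v w I) := by
  funext m
  rw [Finset.sum_apply]
  by_cases hm : toR d m ∈ coneSet d n v w
  · obtain ⟨I, hI, hmI⟩ := exists_isLexSupport_mem_openCone hm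
    rw [Finset.sum_eq_single_of_mem I (by simpa using hI)]
    · simp [genSeries, hm, hmI]
    · intro J hJ hJI
      have : toR d m ∉ openCone v w J := fun hmJ =>
        hJI (IsLexSupport.eq_of_mem (by simpa using hJ) hI hmJ hmI)
      simp [genSeries, this]
  · rw [Finset.sum_eq_zero]
    · simp [genSeries, hm]
    · intro I _
      have : toR d m ∉ openCone v w I := fun h => hm (openCone_subset_coneSet v w I h)
      simp [genSeries, this]

lemma memPL_coneSet {d n : ℕ} (v : Fin d → ℝ) (w : Fin n → Fin d → ℤ) :
    MemPL d (genSeries d (coneSet d n v w)) := by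
  rw [genSeries_coneSet_eq_sum]
  refine Finset.sum_induction _ (MemPL d) (fun _ _ => MemPL.add) (memPL_zero d) fun I hI => ?_
  exact memPL_openCone v w I (IsLexSupport.linearIndepOn (by simpa using hI))

lemma actLP_genSeries_of_image_eq {d : ℕ} {K : Set (Fin d → ℝ)} {w : Fin d → ℤ}
    (hK : (fun y => toR d w + y) '' K = K) :
    actLP d (Finsupp.single w (1 : ℂ)) (genSeries d K) = genSeries d K := by
  funext m
  have h : toR d (m - w) ∈ K ↔ toR d m ∈ K := by
    have hsub : toR d (m - w) = toR d m - toR d w := by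
      funext i
      simp [toR]
    conv_rhs => rw [← hK]
    rw [hsub]
    constructor
    · exact fun h => ⟨_, h, by simp⟩
    · rintro ⟨y, hy, hym⟩
      simpa [← hym] using hy
  simp [actLP_single_apply, genSeries, h]

end PolyhedralSeries

/-- **Lemma.** If `S ∈ PL` satisfies `x^w·S = S` for some nonzero `w ∈ ℤ^d`,
then `φ(S) = 0`; in particular `φ(S_K) = 0` for any rational polyhedral cone `K` that is
not strictly convex (`w + K = K` for some nonzero integer vector `w`). -/
theorem statement5 (d : ℕ) (φ : ((Fin d → ℤ) → ℂ) → RatF d) (hφ : IsPhi d φ) :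
    (∀ S, MemPL d S → ∀ w : Fin d → ℤ, w ≠ 0 →
        actLP d (Finsupp.single w (1 : ℂ)) S = S → φ S = 0) ∧
    (∀ (n : ℕ) (v : Fin d → ℝ) (wgen : Fin n → Fin d → ℤ) (w : Fin d → ℤ), w ≠ 0 →
        (fun y => toR d w + y) '' coneSet d n v wgen = coneSet d n v wgen →
        φ (genSeries d (coneSet d n v wgen)) = 0) := by
  refine ⟨fun S hS w hw h => PolyhedralSeries.phi_eq_zero_of_periodic hφ hS hw h,
    fun n v wgen w hw h => ?_⟩
  exact PolyhedralSeries.phi_eq_zero_of_periodic hφ (PolyhedralSeries.memPL_coneSet v wgen) hw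
    (PolyhedralSeries.actLP_genSeries_of_image_eq h)

end
end

section
/- (Brion's Formula) Let P ⊂ ℝ^d be a polytope with rational vertices (more generally, with vertices in ℝ^d and rational edge directions), and for each vertex v let K_v = v + Σ_w ℝ_{≥0}w be the vertex tangent cone, where w runs over the edge directions of P at v. Then in ℂ(x_1,…,x_d): σ_P(x) = Σ_{v vertex of P} φ(S_{K_v}), where σ_P(x) = Σ_{m ∈ P∩ℤ^d} x^m is the Laurent polynomial listing the integer points of P. -/
open scoped BigOperators Classical

noncomputable section

/-- The indicator of nonemptiness, i.e. the Euler characteristic of a closed convex set. -/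
def nonemptyInd {E : Type*} (s : Set E) : ℤ := if s.Nonempty then 1 else 0

lemma nonemptyInd_split {E : Type*} [AddCommGroup E] [Module ℝ E] {L : Set E} (hL : Convex ℝ L)
    (f : E →ₗ[ℝ] ℝ) :
    nonemptyInd (L ∩ {x | 0 ≤ f x}) + nonemptyInd (L ∩ {x | f x ≤ 0}) =
      nonemptyInd L + nonemptyInd (L ∩ {x | f x = 0}) := by
  have hzero : (L ∩ {x | 0 ≤ f x}).Nonempty → (L ∩ {x | f x ≤ 0}).Nonempty →
      (L ∩ {x | f x = 0}).Nonempty := by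
    rintro ⟨x, hx, hfx⟩ ⟨y, hy, hfy⟩
    simp only [Set.mem_ofPred_eq] at hfx hfy
    by_cases h : f x = 0
    · exact ⟨x, hx, h⟩
    have hpos : 0 < f x - f y := by
      have := lt_of_le_of_ne hfx (Ne.symm h)
      linarith
    refine ⟨(-f y / (f x - f y)) • x + (f x / (f x - f y)) • y,
      hL hx hy (div_nonneg (by linarith) hpos.le) (div_nonneg hfx hpos.le) ?_, ?_⟩
    · field_simp
      ring
    · simp only [Set.mem_ofPred_eq, map_add, map_smul, smul_eq_mul]
      ring
  have hcover : L.Nonempty → (L ∩ {x | 0 ≤ f x}).Nonempty ∨ (L ∩ {x | f x ≤ 0}).Nonempty := by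
    rintro ⟨x, hx⟩
    rcases le_total 0 (f x) with h | h
    · exact Or.inl ⟨x, hx, h⟩
    · exact Or.inr ⟨x, hx, h⟩
  have hpos : (L ∩ {x | f x = 0}).Nonempty → (L ∩ {x | 0 ≤ f x}).Nonempty :=
    fun ⟨x, hx, h⟩ => ⟨x, hx, le_of_eq (Eq.symm h)⟩
  have hneg : (L ∩ {x | f x = 0}).Nonempty → (L ∩ {x | f x ≤ 0}).Nonempty :=
    fun ⟨x, hx, h⟩ => ⟨x, hx, le_of_eq h⟩
  have hl : (L ∩ {x | 0 ≤ f x}).Nonempty → L.Nonempty := fun h => h.mono Set.inter_subset_left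
  have hr : (L ∩ {x | f x ≤ 0}).Nonempty → L.Nonempty := fun h => h.mono Set.inter_subset_left
  unfold nonemptyInd
  split_ifs <;> tauto

lemma sum_nonemptyInd_face_eq {E ι : Type*} [AddCommGroup E] [Module ℝ E] (f : ι → E →ₗ[ℝ] ℝ)
    (A : Finset ι) : ∀ {L : Set E}, Convex ℝ L →
    ∑ I ∈ A.powerset, (-1 : ℤ) ^ I.card *
        nonemptyInd (L ∩ {x | (∀ i ∈ A, 0 ≤ f i x) ∧ ∀ i ∈ I, f i x = 0}) =
      ∑ I ∈ A.powerset, (-1 : ℤ) ^ I.card * nonemptyInd (L ∩ {x | ∀ i ∈ I, f i x ≤ 0}) := by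
  induction A using Finset.induction_on with
  | empty => intro L _; simp
  | insert a A ha ih =>
    intro L hL
    have hconv : ∀ s : Set ℝ, Convex ℝ s → Convex ℝ (L ∩ {x | f a x ∈ s}) := fun s hs =>
      hL.inter (hs.linear_preimage (f a))
    have hp := ih (hconv (Set.Ici 0) (convex_Ici 0))
    have hz := ih (hconv {0} (convex_singleton 0))
    have hcard : ∀ I ∈ A.powerset, (insert a I).card = I.card + 1 := fun I hI =>
      Finset.card_insert_of_notMem fun h => ha (Finset.mem_powerset.mp hI h)
    simp only [Set.mem_Ici, Set.mem_singleton_iff] at hp hz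
    rw [Finset.sum_powerset_insert ha, Finset.sum_powerset_insert ha]
    have e1 : ∀ I : Finset ι, L ∩ {x | (∀ i ∈ insert a A, 0 ≤ f i x) ∧ ∀ i ∈ I, f i x = 0} =
        L ∩ {x | 0 ≤ f a x} ∩ {x | (∀ i ∈ A, 0 ≤ f i x) ∧ ∀ i ∈ I, f i x = 0} := by
      intro I; ext x; simp; tauto
    have e2 : ∀ I : Finset ι, L ∩ {x | (∀ i ∈ insert a A, 0 ≤ f i x) ∧ ∀ i ∈ insert a I, f i x = 0} =
        L ∩ {x | f a x = 0} ∩ {x | (∀ i ∈ A, 0 ≤ f i x) ∧ ∀ i ∈ I, f i x = 0} := by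
      intro I; ext x
      simp only [Finset.forall_mem_insert, Set.mem_inter_iff, Set.mem_ofPred_eq]
      constructor
      · tauto
      · rintro ⟨⟨h1, h2⟩, h3, h4⟩
        exact ⟨h1, ⟨h2.ge, h3⟩, h2, h4⟩
    have s2 : ∀ g : Finset ι → ℤ, ∑ I ∈ A.powerset, (-1 : ℤ) ^ (insert a I).card * g I =
        -∑ I ∈ A.powerset, (-1 : ℤ) ^ I.card * g I := by
      intro g
      rw [← Finset.sum_neg_distrib]
      refine Finset.sum_congr rfl fun I hI => ?_
      rw [hcard I hI]; ring
    simp only [e2]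
    simp only [e1]
    rw [s2, s2, hp, hz, ← sub_eq_add_neg, ← sub_eq_add_neg, ← Finset.sum_sub_distrib,
      ← Finset.sum_sub_distrib]
    refine Finset.sum_congr rfl fun I _ => ?_
    have hLI : Convex ℝ (L ∩ {x | ∀ i ∈ I, f i x ≤ 0}) := by
      refine hL.inter ?_
      have : {x | ∀ i ∈ I, f i x ≤ 0} = ⋂ i ∈ I, f i ⁻¹' Set.Iic 0 := by ext; simp
      rw [this]
      exact convex_iInter₂ fun i _ => (convex_Iic 0).linear_preimage (f i)
    have key := nonemptyInd_split hLI (f a)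
    have e3 : L ∩ {x | ∀ i ∈ insert a I, f i x ≤ 0} =
        L ∩ {x | ∀ i ∈ I, f i x ≤ 0} ∩ {x | f a x ≤ 0} := by
      ext x; simp; tauto
    rw [e3, Set.inter_right_comm L {x | 0 ≤ f a x}, Set.inter_right_comm L {x | f a x = 0},
      ← mul_sub, ← mul_sub]
    congr 1
    linarith

/-- The cone `v + Σ_{i ∈ s} ℝ_{≥0} wᵢ`. -/
def famCone {ι : Type*} (d : ℕ) (v : Fin d → ℝ) (w : ι → Fin d → ℤ) (s : Finset ι) :
    Set (Fin d → ℝ) :=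
  {y | ∃ lam : ι → ℝ, (∀ i ∈ s, 0 ≤ lam i) ∧ y = v + ∑ i ∈ s, lam i • toR d (w i)}

lemma genSeries_apply_eq_nonemptyInd {E : Type*} (d : ℕ) {S : Set (Fin d → ℝ)} {m : Fin d → ℤ}
    {L : Set E} (h : toR d m ∈ S ↔ L.Nonempty) : genSeries d S m = (nonemptyInd L : ℂ) := by
  simp only [genSeries, nonemptyInd, h]
  split_ifs <;> simp

/-- A positive linear dependence among the generators of a cone expresses it in terms of the cones
obtained by removing generators. -/
lemma sum_genSeries_famCone_sdiff {ι : Type*} (d : ℕ) (v : Fin d → ℝ) (w : ι → Fin d → ℤ)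
    (s : Finset ι) (c : ι → ℝ) (hc : ∑ i ∈ s, c i • toR d (w i) = 0)
    (hpos : ∃ i ∈ s, 0 < c i) :
    ∑ I ∈ (s.filter (0 < c ·)).powerset,
      (-1 : ℤ) ^ I.card • genSeries d (famCone d v w (s \ I)) = 0 := by
  set A := s.filter (0 < c ·) with hA
  have hAne : A.Nonempty := by
    obtain ⟨i, hi, h⟩ := hpos
    exact ⟨i, by simp [hA, hi, h]⟩
  funext m
  let L : Set (ι → ℝ) :=
    {lam | v + ∑ i ∈ s, lam i • toR d (w i) = toR d m ∧ ∀ i ∈ s, i ∉ A → 0 ≤ lam i}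
  have hL : Convex ℝ L := by
    rintro x ⟨hx, hx'⟩ y ⟨hy, hy'⟩ a b ha hb hab
    refine ⟨?_, fun i hi hiA => ?_⟩
    · have : v + ∑ i ∈ s, (a • x + b • y) i • toR d (w i) =
          a • (v + ∑ i ∈ s, x i • toR d (w i)) + b • (v + ∑ i ∈ s, y i • toR d (w i)) := by
        simp only [Pi.add_apply, Pi.smul_apply, smul_eq_mul, add_smul, mul_smul,
          Finset.sum_add_distrib, ← Finset.smul_sum, smul_add]
        have : v = a • v + b • v := by rw [← add_smul, hab, one_smul]
        nth_rewrite 1 [this]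
        abel
      rw [this, hx, hy, ← add_smul, hab, one_smul]
    · have h1 := hx' i hi hiA
      have h2 := hy' i hi hiA
      simp only [Pi.add_apply, Pi.smul_apply, smul_eq_mul]
      positivity
  have key := sum_nonemptyInd_face_eq (fun i => LinearMap.proj (R := ℝ) (φ := fun _ : ι => ℝ) i) A hL
  have hface : ∀ I ∈ A.powerset, toR d m ∈ famCone d v w (s \ I) ↔
      (L ∩ {x | (∀ i ∈ A, 0 ≤ LinearMap.proj (R := ℝ) (φ := fun _ : ι => ℝ) i x) ∧
        ∀ i ∈ I, LinearMap.proj (R := ℝ) (φ := fun _ : ι => ℝ) i x = 0}).Nonempty := by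
    intro I hI
    rw [Finset.mem_powerset] at hI
    have hIs : I ⊆ s := hI.trans (Finset.filter_subset _ _)
    constructor
    · rintro ⟨lam, h0, hm⟩
      refine ⟨fun i => if i ∈ I then 0 else lam i, ⟨?_, ?_⟩, ?_, ?_⟩
      · rw [hm, ← Finset.sum_sdiff hIs]
        congr 1
        rw [Finset.sum_eq_zero (s := I) (fun i hi => by simp [hi]), add_zero]
        exact Finset.sum_congr rfl fun i hi => by simp [(Finset.mem_sdiff.mp hi).2]
      · intro i hi hiA
        have : i ∉ I := fun h => hiA (hI h)
        simp only [this, if_false]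
        exact h0 i (by simp [hi, this])
      · intro i hi
        by_cases hiI : i ∈ I
        · simp [hiI]
        · simp only [LinearMap.proj_apply, hiI, if_false]
          exact h0 i (by simp [(Finset.mem_filter.mp hi).1, hiI])
      · intro i hi
        simp [hi]
    · rintro ⟨lam, ⟨hm, h1⟩, h2, h3⟩
      refine ⟨lam, fun i hi => ?_, ?_⟩
      · by_cases hiA : i ∈ A
        · exact h2 i hiA
        · exact h1 i (Finset.mem_sdiff.mp hi).1 hiA
      · rw [← hm, ← Finset.sum_sdiff hIs, Finset.sum_eq_zero (s := I), add_zero]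
        intro i hi
        have := h3 i hi
        simp only [LinearMap.proj_apply] at this
        simp [this]
  have hhalf : ∀ I ∈ A.powerset, nonemptyInd
      (L ∩ {x | ∀ i ∈ I, LinearMap.proj (R := ℝ) (φ := fun _ : ι => ℝ) i x ≤ 0}) =
        nonemptyInd L := by
    intro I hI
    rw [Finset.mem_powerset] at hI
    have : (L ∩ {x | ∀ i ∈ I, LinearMap.proj (R := ℝ) (φ := fun _ : ι => ℝ) i x ≤ 0}).Nonempty ↔
        L.Nonempty := by
      refine ⟨fun h => h.mono Set.inter_subset_left, ?_⟩
      rintro ⟨x, hx1, hx2⟩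
      obtain ⟨t, ht⟩ : ∃ t : ℝ, ∀ i ∈ A, |x i| / c i ≤ t := by
        refine ⟨A.sup' hAne fun i => |x i| / c i, fun i hi => ?_⟩
        exact Finset.le_sup' (fun i => |x i| / c i) hi
      have hcA : ∀ i ∈ A, 0 < c i := fun i hi => (Finset.mem_filter.mp hi).2
      have ht0 : 0 ≤ t := by
        obtain ⟨i, hi⟩ := hAne
        exact (div_nonneg (abs_nonneg _) (hcA i hi).le).trans (ht i hi)
      refine ⟨x - t • c, ⟨?_, ?_⟩, ?_⟩
      · simp only [Pi.sub_apply, Pi.smul_apply, smul_eq_mul, sub_smul, mul_smul,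
          Finset.sum_sub_distrib, ← Finset.smul_sum, hc, smul_zero, sub_zero]
        exact hx1
      · intro i hi hiA
        have h1 := hx2 i hi hiA
        have h2 : c i ≤ 0 := by
          by_contra! h
          exact hiA (Finset.mem_filter.mpr ⟨hi, h⟩)
        simp only [Pi.sub_apply, Pi.smul_apply, smul_eq_mul]
        nlinarith
      · intro i hi
        have h1 := ht i (hI hi)
        rw [div_le_iff₀ (hcA i (hI hi))] at h1
        have := le_abs_self (x i)
        simp only [LinearMap.proj_apply, Pi.sub_apply, Pi.smul_apply, smul_eq_mul]
        linarith
    simp only [nonemptyInd, this]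
  have hsum := Finset.sum_congr rfl fun I hI =>
    congrArg (fun n : ℤ => (-1 : ℤ) ^ I.card * n) (hhalf I hI)
  rw [hsum, ← Finset.sum_mul, Finset.sum_powerset_neg_one_pow_card_of_nonempty hAne,
    zero_mul] at key
  rw [Finset.sum_apply, Pi.zero_apply]
  have hterm := Finset.sum_congr (rfl : A.powerset = A.powerset) fun I hI =>
    congrArg (fun z : ℂ => (-1 : ℤ) ^ I.card • z)
      (genSeries_apply_eq_nonemptyInd d (hface I hI))
  simp only [Pi.smul_apply]
  rw [hterm]
  simp only [zsmul_eq_mul]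
  exact_mod_cast key

lemma actLP_eq_sum (d : ℕ) (g : LaurentPoly d) (S : (Fin d → ℤ) → ℂ) (m : Fin d → ℤ) :
    actLP d g S m = g.sum fun w c => c * S (m - w) := rfl

lemma actLP_single (d : ℕ) (w : Fin d → ℤ) (c : ℂ) (S : (Fin d → ℤ) → ℂ) (m : Fin d → ℤ) :
    actLP d (Finsupp.single w c) S m = c * S (m - w) := by
  rw [actLP_eq_sum, Finsupp.sum_single_index (by simp)]

lemma actLP_neg (d : ℕ) (g : LaurentPoly d) (S : (Fin d → ℤ) → ℂ) :
    actLP d (-g) S = -actLP d g S := by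
  funext m
  simp [actLP]

lemma toRat_single (d : ℕ) (w : Fin d → ℤ) : toRat d (Finsupp.single w 1) = ratMon d w := by
  simp [toRat]

/-- The additive group of polyhedral Laurent series. -/
def polyhedralSeries (d : ℕ) : AddSubgroup ((Fin d → ℤ) → ℂ) where
  carrier := {S | MemPL d S}
  zero_mem' := ⟨0, Fin.elim0, Fin.elim0, fun i => i.elim0, by simp⟩
  add_mem' := by
    rintro _ _ ⟨n, g, K, hK, rfl⟩ ⟨n', g', K', hK', rfl⟩
    refine ⟨n + n', Fin.append g g', Fin.append K K', fun i => ?_, ?_⟩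
    · induction i using Fin.addCases <;> simp [hK, hK']
    · simp [Fin.sum_univ_add]
  neg_mem' := by
    rintro _ ⟨n, g, K, hK, rfl⟩
    exact ⟨n, fun i => -g i, K, hK, by simp [actLP_neg]⟩

lemma mem_polyhedralSeries {d : ℕ} {S : (Fin d → ℤ) → ℂ} :
    S ∈ polyhedralSeries d ↔ MemPL d S := Iff.rfl

/-- The restriction of `φ` to the polyhedral Laurent series. -/
def phiHom (d : ℕ) (φ : ((Fin d → ℤ) → ℂ) → RatF d) (hφ : IsPhi d φ) :
    polyhedralSeries d →+ RatF d :=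
  AddMonoidHom.mk' (fun S => φ S) fun S T => hφ.1 S T S.2 T.2

lemma phi_sum_zsmul {d : ℕ} {φ : ((Fin d → ℤ) → ℂ) → RatF d} (hφ : IsPhi d φ) {ι : Type*}
    (s : Finset ι) (n : ι → ℤ) (S : ι → (Fin d → ℤ) → ℂ) (hS : ∀ i ∈ s, MemPL d (S i)) :
    φ (∑ i ∈ s, n i • S i) = ∑ i ∈ s, (n i : RatF d) * φ (S i) := by
  have h := map_sum (phiHom d φ hφ) (fun i : s => n i • (⟨S i, hS i i.2⟩ : polyhedralSeries d))
    Finset.univ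
  have hval : ((∑ i : s, n i • (⟨S i, hS i i.2⟩ : polyhedralSeries d) : polyhedralSeries d) :
      (Fin d → ℤ) → ℂ) = ∑ i ∈ s, n i • S i := by
    rw [AddSubgroup.val_finsetSum, ← Finset.sum_coe_sort s]
    rfl
  rw [← hval, ← Finset.sum_coe_sort s fun i => (n i : RatF d) * φ (S i)]
  refine h.trans (Finset.sum_congr rfl fun i _ => ?_)
  rw [map_zsmul, zsmul_eq_mul]
  rfl

lemma genSeries_simpleCone_mem (d : ℕ) {K : Set (Fin d → ℝ)} (hK : IsSimpleCone d K) :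
    MemPL d (genSeries d K) := by
  refine ⟨1, fun _ => Finsupp.single 0 1, fun _ => K, fun _ => hK, ?_⟩
  funext m
  simp [actLP_single]

lemma toR_sub (d : ℕ) (m n : Fin d → ℤ) : toR d (m - n) = toR d m - toR d n := by
  funext i; simp [toR]

lemma toR_injective (d : ℕ) : Function.Injective (toR d) := fun m n h => by
  funext i; exact Int.cast_injective (congrFun h i)

lemma exists_int_orthogonal {d n : ℕ} (hn : n < d) (w : Fin n → Fin d → ℤ) :
    ∃ a : Fin d → ℤ, a ≠ 0 ∧ ∀ i, w i ⬝ᵥ a = 0 := by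
  by_contra! h
  have hinj : Function.Injective (Matrix.mulVecLin (Matrix.of w)) := by
    rw [injective_iff_map_eq_zero]
    intro a ha
    by_contra h0
    obtain ⟨i, hi⟩ := h a h0
    exact hi (congrFun ha i)
  exact absurd (le_of_fin_injective ℤ _ hinj) (by omega)

lemma toR_dotProduct (d : ℕ) (m n : Fin d → ℤ) :
    toR d m ⬝ᵥ toR d n = ((m ⬝ᵥ n : ℤ) : ℝ) := by
  simp [toR, dotProduct]

lemma genSeries_coneSet_mem_of_linearIndependent (d : ℕ) : ∀ (k n : ℕ) (v : Fin d → ℝ)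
    (w : Fin n → Fin d → ℤ), n + k = d → LinearIndependent ℝ (fun i => toR d (w i)) →
    MemPL d (genSeries d (coneSet d n v w)) := by
  intro k
  induction k with
  | zero =>
    intro n v w hn hw
    obtain rfl : n = d := by omega
    exact genSeries_simpleCone_mem n ⟨v, w, hw, rfl⟩
  | succ k ih =>
    intro n v w hn hw
    obtain ⟨a, ha0, ha⟩ := exists_int_orthogonal (by omega : n < d) w
    set D : ℝ := toR d a ⬝ᵥ toR d a with hD
    have hDpos : 0 < D := by
      have h0 : toR d a ≠ 0 := fun h => ha0 (toR_injective d (h.trans (by funext i; simp [toR])))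
      have h1 : D ≠ 0 := fun h => h0 (dotProduct_self_eq_zero.mp h)
      have h2 : 0 ≤ D := Finset.sum_nonneg fun i _ => mul_self_nonneg _
      exact lt_of_le_of_ne h2 (Ne.symm h1)
    have hort : ∀ i, toR d (w i) ⬝ᵥ toR d a = 0 := fun i => by
      rw [toR_dotProduct, ha i, Int.cast_zero]
    have hsum : ∀ lam : Fin n → ℝ, (∑ i, lam i • toR d (w i)) ⬝ᵥ toR d a = 0 := fun lam => by
      rw [sum_dotProduct]
      exact Finset.sum_eq_zero fun i _ => by rw [smul_dotProduct, hort, smul_zero]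
    have hw' : LinearIndependent ℝ fun i => toR d ((Fin.cons a w : Fin (n + 1) → Fin d → ℤ) i) := by
      have : (fun i => toR d ((Fin.cons a w : Fin (n + 1) → Fin d → ℤ) i)) =
          Fin.cons (toR d a) fun i => toR d (w i) := by
        funext i
        cases i using Fin.cases <;> simp
      rw [this, linearIndependent_finCons]
      refine ⟨hw, fun h => ?_⟩
      obtain ⟨c, hc⟩ := (Submodule.mem_span_range_iff_exists_fun ℝ).mp h
      have := hsum c
      rw [hc] at this
      exact hDpos.ne' this
    set x : ℝ := v ⬝ᵥ toR d a with hx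
    set ε : ℝ := (⌊x⌋ + 1 - x) / D with hε
    have hεpos : 0 < ε := div_pos (by have := Int.lt_floor_add_one x; linarith) hDpos
    have h1 := ih (n + 1) v (Fin.cons a w) (by omega) hw'
    have h2 := ih (n + 1) (v + ε • toR d a) (Fin.cons a w) (by omega) hw'
    have hdiff : genSeries d (coneSet d n v w) =
        genSeries d (coneSet d (n + 1) v (Fin.cons a w)) -
          genSeries d (coneSet d (n + 1) (v + ε • toR d a) (Fin.cons a w)) := by
      funext m
      have hbig : toR d m ∈ coneSet d (n + 1) v (Fin.cons a w) ↔
          toR d m ∈ coneSet d n v w ∨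
            toR d m ∈ coneSet d (n + 1) (v + ε • toR d a) (Fin.cons a w) := by
        constructor
        · rintro ⟨lam, h0, hm⟩
          simp only [Fin.sum_univ_succ, Fin.cons_zero, Fin.cons_succ] at hm
          by_cases hz : lam 0 = 0
          · exact Or.inl ⟨fun i => lam i.succ, fun i => h0 _, by rw [hm, hz]; simp⟩
          · right
            have hpos : 0 < lam 0 := lt_of_le_of_ne (h0 0) (Ne.symm hz)
            have hdot : ((m ⬝ᵥ a : ℤ) : ℝ) = x + lam 0 * D := by
              rw [← toR_dotProduct, hm, add_dotProduct, add_dotProduct, hsum, smul_dotProduct]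
              simp [hx, hD]
            have hge : ε ≤ lam 0 := by
              rw [hε, div_le_iff₀ hDpos]
              have hlt : x < ((m ⬝ᵥ a : ℤ) : ℝ) := by
                rw [hdot]; linarith [mul_pos hpos hDpos]
              have := Int.floor_lt.mpr hlt
              have : ((⌊x⌋ + 1 : ℤ) : ℝ) ≤ ((m ⬝ᵥ a : ℤ) : ℝ) := by exact_mod_cast this
              push_cast at this
              linarith
            refine ⟨Fin.cons (lam 0 - ε) fun i => lam i.succ, fun i => ?_, ?_⟩
            · cases i using Fin.cases with
              | zero => simpa using hge
              | succ i => simpa using h0 _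
            · rw [hm]
              simp only [Fin.sum_univ_succ, Fin.cons_zero, Fin.cons_succ, sub_smul]
              abel
        · rintro (⟨lam, h0, hm⟩ | ⟨lam, h0, hm⟩)
          · refine ⟨Fin.cons 0 lam, fun i => ?_, ?_⟩
            · cases i using Fin.cases with
              | zero => simp
              | succ i => simpa using h0 _
            · rw [hm]
              simp [Fin.sum_univ_succ]
          · refine ⟨Fin.cons (lam 0 + ε) fun i => lam i.succ, fun i => ?_, ?_⟩
            · cases i using Fin.cases with
              | zero => simpa using add_nonneg (h0 0) hεpos.le
              | succ i => simpa using h0 _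
            · rw [hm]
              simp only [Fin.sum_univ_succ, Fin.cons_zero, Fin.cons_succ, add_smul]
              abel
      have hdisj : toR d m ∈ coneSet d n v w →
          toR d m ∉ coneSet d (n + 1) (v + ε • toR d a) (Fin.cons a w) := by
        rintro ⟨lam, h0, hm⟩ ⟨mu, h0', hm'⟩
        have e1 := congrArg (· ⬝ᵥ toR d a) hm
        have e2 := congrArg (· ⬝ᵥ toR d a) hm'
        simp only [Fin.sum_univ_succ, Fin.cons_zero, Fin.cons_succ, add_dotProduct, hsum,
          smul_dotProduct, smul_eq_mul, ← hD] at e1 e2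
        have := mul_pos hεpos hDpos
        have := mul_nonneg (h0' 0) hDpos.le
        linarith
      simp only [Pi.sub_apply, genSeries, hbig]
      by_cases p : toR d m ∈ coneSet d n v w
      · simp [p, hdisj p]
      · simp [p]
    rw [hdiff]
    exact (polyhedralSeries d).sub_mem h1 h2

lemma genSeries_famCone_mem {ι : Type*} (d : ℕ) (v : Fin d → ℝ) (w : ι → Fin d → ℤ)
    (s : Finset ι) : MemPL d (genSeries d (famCone d v w s)) := by
  induction s using Finset.strongInduction with
  | H s ih =>
    by_cases hli : LinearIndependent ℝ fun i : s => toR d (w i)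
    · have hcard : s.card ≤ d := by
        have := hli.fintype_card_le_finrank
        simpa using this
      let e := s.equivFin
      have hcone : famCone d v w s = coneSet d s.card v fun j => w (e.symm j) := by
        ext y
        constructor
        · rintro ⟨lam, h0, rfl⟩
          refine ⟨fun j => lam (e.symm j), fun j => h0 _ (e.symm j).2, ?_⟩
          rw [← Finset.sum_coe_sort s, ← e.symm.sum_comp]
        · rintro ⟨lam, h0, rfl⟩
          refine ⟨fun i => if h : i ∈ s then lam (e ⟨i, h⟩) else 0, fun i hi => ?_, ?_⟩
          · simpa [hi] using h0 _
          · rw [← Finset.sum_coe_sort s, ← e.symm.sum_comp]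
            simp
      rw [hcone]
      exact genSeries_coneSet_mem_of_linearIndependent d (d - s.card) s.card v _ (by omega)
        ((linearIndependent_equiv e.symm).mpr hli)
    · obtain ⟨c, hc, hpos⟩ : ∃ c : ι → ℝ, ∑ i ∈ s, c i • toR d (w i) = 0 ∧ ∃ i ∈ s, 0 < c i := by
        rw [Fintype.not_linearIndependent_iff] at hli
        obtain ⟨g, hg, i, hi⟩ := hli
        let c : ι → ℝ := fun i => if h : i ∈ s then g ⟨i, h⟩ else 0
        have hc : ∑ i ∈ s, c i • toR d (w i) = 0 := by
          rw [← Finset.sum_coe_sort s]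
          simpa [c] using hg
        rcases lt_or_gt_of_ne hi with h | h
        · exact ⟨-c, by simp [hc], i, i.2, by simpa [c] using h⟩
        · exact ⟨c, hc, i, i.2, by simpa [c] using h⟩
      have key := sum_genSeries_famCone_sdiff d v w s c hc hpos
      set A := s.filter (0 < c ·) with hA
      rw [← Finset.add_sum_erase _ _ (Finset.empty_mem_powerset A)] at key
      simp only [Finset.card_empty, pow_zero, one_smul, Finset.sdiff_empty] at key
      rw [eq_neg_of_add_eq_zero_left key]
      refine (polyhedralSeries d).neg_mem ((polyhedralSeries d).sum_mem fun I hI =>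
        (polyhedralSeries d).zsmul_mem (ih _ ?_) _)
      obtain ⟨hI0, hIA⟩ := Finset.mem_erase.mp hI
      obtain ⟨i, hi⟩ := Finset.nonempty_iff_ne_empty.mpr hI0
      refine Finset.ssubset_iff_subset_ne.mpr ⟨Finset.sdiff_subset, fun h => ?_⟩
      have his : i ∈ s := (Finset.mem_filter.mp (Finset.mem_powerset.mp hIA hi)).1
      rw [← h] at his
      exact (Finset.mem_sdiff.mp his).2 hi

lemma ratMon_zero (d : ℕ) : ratMon d 0 = 1 := by simp [ratMon]

lemma ratMon_mul_monomial (d : ℕ) (w : Fin d → ℤ) :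
    ratMon d w * algebraMap (MvPolynomial (Fin d) ℂ) (RatF d)
        (MvPolynomial.monomial (Finsupp.equivFunOnFinite.symm fun i => (-w i).toNat) 1) =
      algebraMap (MvPolynomial (Fin d) ℂ) (RatF d)
        (MvPolynomial.monomial (Finsupp.equivFunOnFinite.symm fun i => (w i).toNat) 1) := by
  have hmon : ∀ n : Fin d → ℕ, algebraMap (MvPolynomial (Fin d) ℂ) (RatF d)
      (MvPolynomial.monomial (Finsupp.equivFunOnFinite.symm n) 1) =
        ∏ i, algebraMap (MvPolynomial (Fin d) ℂ) (RatF d) (MvPolynomial.X i) ^ n i := fun n => by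
    rw [MvPolynomial.monomial_eq, map_one, one_mul, Finsupp.prod_fintype _ _ (by simp), map_prod]
    simp
  rw [hmon, hmon, ratMon, ← Finset.prod_mul_distrib]
  refine Finset.prod_congr rfl fun i _ => ?_
  have hX : algebraMap (MvPolynomial (Fin d) ℂ) (RatF d) (MvPolynomial.X i) ≠ 0 := by
    rw [Ne, FaithfulSMul.algebraMap_eq_zero_iff]
    exact MvPolynomial.X_ne_zero i
  rw [← zpow_natCast, ← zpow_natCast, ← zpow_add₀ hX]
  congr 1
  omega

lemma ratMon_ne_one (d : ℕ) {w : Fin d → ℤ} (hw : w ≠ 0) : ratMon d w ≠ 1 := by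
  intro h
  have key := ratMon_mul_monomial d w
  rw [h, one_mul] at key
  have h1 := MvPolynomial.monomial_left_injective (one_ne_zero : (1 : ℂ) ≠ 0)
    (FaithfulSMul.algebraMap_injective _ _ key)
  apply hw
  funext i
  have := congrFun (Finsupp.equivFunOnFinite.symm.injective h1) i
  simp only [Pi.zero_apply] at this ⊢
  omega

lemma phi_eq_zero_of_periodic {d : ℕ} {φ : ((Fin d → ℤ) → ℂ) → RatF d} (hφ : IsPhi d φ)
    {S : (Fin d → ℤ) → ℂ} (hS : MemPL d S) {w : Fin d → ℤ} (hw : w ≠ 0)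
    (hper : ∀ m, S (m - w) = S m) : φ S = 0 := by
  have h := hφ.2.1 (Finsupp.single w 1) S hS
  rw [toRat_single, (by funext m; rw [actLP_single, one_mul, hper] :
    actLP d (Finsupp.single w 1) S = S)] at h
  by_contra h0
  exact ratMon_ne_one d hw (mul_right_cancel₀ h0 (by rw [one_mul]; exact h.symm))

lemma phi_famCone_translate {ι : Type*} {d : ℕ} {φ : ((Fin d → ℤ) → ℂ) → RatF d}
    (hφ : IsPhi d φ) (a : Fin d → ℤ) (v : Fin d → ℝ) (w : ι → Fin d → ℤ) (s : Finset ι) :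
    φ (genSeries d (famCone d (v + toR d a) w s)) =
      ratMon d a * φ (genSeries d (famCone d v w s)) := by
  rw [← toRat_single, ← hφ.2.1 _ _ (genSeries_famCone_mem d v w s)]
  congr 1
  funext m
  have : toR d m ∈ famCone d (v + toR d a) w s ↔ toR d (m - a) ∈ famCone d v w s := by
    simp only [famCone, Set.mem_ofPred_eq, toR_sub, sub_eq_iff_eq_add, add_right_comm v]
  simp only [actLP_single, genSeries, this, one_mul]

lemma mem_famCone_single {d : ℕ} {v y : Fin d → ℝ} {T : Finset (Fin d)} :
    y ∈ famCone d v (fun i => Pi.single i 1) T ↔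
      (∀ i ∈ T, v i ≤ y i) ∧ ∀ i ∉ T, y i = v i := by
  have hsum : ∀ (lam : Fin d → ℝ) (j : Fin d),
      (v + ∑ i ∈ T, lam i • toR d (Pi.single i 1)) j = v j + if j ∈ T then lam j else 0 := by
    intro lam j
    simp [toR, Finset.sum_apply, Pi.single_apply]
  constructor
  · rintro ⟨lam, h0, rfl⟩
    refine ⟨fun i hi => ?_, fun i hi => ?_⟩
    · rw [hsum, if_pos hi]; linarith [h0 i hi]
    · rw [hsum, if_neg hi, add_zero]
  · rintro ⟨h1, h2⟩
    refine ⟨fun i => y i - v i, fun i hi => sub_nonneg.mpr (h1 i hi), ?_⟩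
    funext j
    rw [hsum]
    split_ifs with hj
    · ring
    · rw [h2 j hj, add_zero]

lemma phi_famCone_single_insert {d : ℕ} {φ : ((Fin d → ℤ) → ℂ) → RatF d} (hφ : IsPhi d φ)
    {T : Finset (Fin d)} {j : Fin d} (hj : j ∉ T) :
    φ (genSeries d (famCone d 0 (fun i => Pi.single i 1) T)) =
      (1 - ratMon d (Pi.single j 1)) *
        φ (genSeries d (famCone d 0 (fun i => Pi.single i 1) (insert j T))) := by
  have hsplit : genSeries d (famCone d 0 (fun i => Pi.single i 1) (insert j T)) =
      genSeries d (famCone d 0 (fun i => Pi.single i 1) T) +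
        genSeries d (famCone d (0 + toR d (Pi.single j 1)) (fun i => Pi.single i 1)
          (insert j T)) := by
    funext m
    have h1 : toR d m ∈ famCone d 0 (fun i => Pi.single i 1) (insert j T) ↔
        0 ≤ m j ∧ (∀ i ∈ T, 0 ≤ m i) ∧ ∀ i ∉ insert j T, m i = 0 := by
      rw [mem_famCone_single]
      simp [toR, and_assoc]
    have h2 : toR d m ∈ famCone d 0 (fun i => Pi.single i 1) T ↔
        m j = 0 ∧ (∀ i ∈ T, 0 ≤ m i) ∧ ∀ i ∉ insert j T, m i = 0 := by
      rw [mem_famCone_single]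
      simp only [toR, Pi.zero_apply, Int.cast_nonneg_iff, Int.cast_eq_zero, Finset.mem_insert,
        not_or, and_imp]
      constructor
      · rintro ⟨h, h'⟩
        exact ⟨h' j hj, h, fun i _ hi => h' i hi⟩
      · rintro ⟨h, h', h''⟩
        refine ⟨h', fun i hi => ?_⟩
        by_cases hij : i = j
        · rw [hij, h]
        · exact h'' i hij hi
    have h3 : toR d m ∈ famCone d (0 + toR d (Pi.single j 1)) (fun i => Pi.single i 1)
        (insert j T) ↔ 1 ≤ m j ∧ (∀ i ∈ T, 0 ≤ m i) ∧ ∀ i ∉ insert j T, m i = 0 := by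
      rw [mem_famCone_single, zero_add, Finset.forall_mem_insert, and_assoc]
      refine and_congr ?_ (and_congr ?_ ?_)
      · simp only [toR, Pi.single_eq_same, Int.cast_le]
      · refine forall₂_congr fun i hi => ?_
        have hij : i ≠ j := fun h => hj (h ▸ hi)
        simp [toR, hij]
      · refine forall₂_congr fun i hi => ?_
        have hij : i ≠ j := fun h => hi (h ▸ Finset.mem_insert_self _ _)
        simp [toR, hij]
    simp only [Pi.add_apply, genSeries, h1, h2, h3]
    by_cases hrest : (∀ i ∈ T, 0 ≤ m i) ∧ ∀ i ∉ insert j T, m i = 0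
    · simp only [eq_true hrest, and_true]
      rcases lt_trichotomy (m j) 0 with h | h | h
      · simp [h.not_ge, h.ne, (show ¬1 ≤ m j by omega)]
      · simp [h]
      · simp [h.le, h.ne', (show 1 ≤ m j by omega)]
    · rw [if_neg fun h => hrest h.2, if_neg fun h => hrest h.2, if_neg fun h => hrest h.2, add_zero]
  have h := hφ.1 _ _ (genSeries_famCone_mem d 0 (fun i => Pi.single i 1) T)
    (genSeries_famCone_mem d (0 + toR d (Pi.single j 1)) (fun i => Pi.single i 1) (insert j T))
  rw [← hsplit, phi_famCone_translate hφ] at h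
  rw [sub_mul, one_mul, eq_sub_iff_add_eq]
  exact h.symm

lemma phi_genSeries_origin {ι : Type*} {d : ℕ} {φ : ((Fin d → ℤ) → ℂ) → RatF d}
    (hφ : IsPhi d φ) (w : ι → Fin d → ℤ) : φ (genSeries d (famCone d 0 w ∅)) = 1 := by
  have hbase : famCone d 0 w ∅ = famCone d 0 (fun i => Pi.single i 1) (∅ : Finset (Fin d)) := by
    ext y
    simp only [famCone, Finset.sum_empty, Set.mem_ofPred_eq, Finset.notMem_empty,
      IsEmpty.forall_iff, implies_true, true_and, exists_const]
  have hprod : ∀ T : Finset (Fin d),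
      φ (genSeries d (famCone d 0 (fun i => Pi.single i 1) (∅ : Finset (Fin d)))) =
        (∏ i ∈ T, (1 - ratMon d (Pi.single i 1))) *
          φ (genSeries d (famCone d 0 (fun i => Pi.single i 1) T)) := by
    intro T
    induction T using Finset.induction_on with
    | empty => simp
    | insert j T hj ih =>
      rw [ih, phi_famCone_single_insert hφ hj, Finset.prod_insert hj]
      ring
  have hli : LinearIndependent ℝ fun i : Fin d => toR d (Pi.single i 1) := by
    have : (fun i : Fin d => toR d (Pi.single i 1)) = Pi.basisFun ℝ (Fin d) := by
      funext i j
      simp [toR, Pi.single_apply]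
    rw [this]
    exact (Pi.basisFun ℝ (Fin d)).linearIndependent
  have hcone : famCone d 0 (fun i => Pi.single i 1) (Finset.univ : Finset (Fin d)) =
      coneSet d d 0 fun i => Pi.single i 1 := by
    ext y
    simp [famCone, coneSet]
  have hpar : {m : Fin d → ℤ | toR d m ∈ parSet d 0 fun i => Pi.single i 1} = {0} := by
    ext m
    have hsum : ∀ lam : Fin d → ℝ, (0 : Fin d → ℝ) + ∑ i, lam i • toR d (Pi.single i 1) = lam := by
      intro lam
      funext j
      simp [toR, Finset.sum_apply, Pi.single_apply]
    simp only [parSet, Set.mem_ofPred_eq, hsum, Set.mem_singleton_iff]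
    constructor
    · rintro ⟨lam, h, rfl⟩
      funext i
      obtain ⟨h0, h1⟩ := h i
      simp only [toR] at h0 h1
      have h0' : 0 ≤ m i := by exact_mod_cast h0
      have h1' : m i < 1 := by exact_mod_cast h1
      simp only [Pi.zero_apply]
      omega
    · rintro rfl
      exact ⟨_, fun i => by simp [toR], rfl⟩
  rw [hbase, hprod Finset.univ, hcone, hφ.2.2 0 _ hli, sigmaSet, hpar, finsum_mem_singleton,
    ratMon_zero, mul_one_div, div_self]
  refine Finset.prod_ne_zero_iff.mpr fun i _ => sub_ne_zero.mpr (Ne.symm (ratMon_ne_one d ?_))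
  simp

/-- On a set with finitely many integer points, `φ` lists those points. -/
lemma genSeries_finite_mem_and_phi {d : ℕ} {φ : ((Fin d → ℤ) → ℂ) → RatF d} (hφ : IsPhi d φ)
    {P : Set (Fin d → ℝ)} (hP : {m : Fin d → ℤ | toR d m ∈ P}.Finite) :
    MemPL d (genSeries d P) ∧ φ (genSeries d P) = sigmaSet d P := by
  let pt : (Fin d → ℤ) → (Fin d → ℤ) → ℂ := fun m =>
    genSeries d (famCone d (0 + toR d m) (fun i => Pi.single i 1) (∅ : Finset (Fin d)))
  have hpt : ∀ m ∈ hP.toFinset, MemPL d (pt m) := fun m _ => genSeries_famCone_mem _ _ _ _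
  have hsum : genSeries d P = ∑ m ∈ hP.toFinset, (1 : ℤ) • pt m := by
    funext n
    have : ∀ m, pt m n = if n = m then 1 else 0 := fun m => by
      simp only [pt, genSeries, famCone, Set.mem_ofPred_eq, Finset.sum_empty, add_zero, zero_add,
        Finset.notMem_empty, IsEmpty.forall_iff, implies_true, true_and, exists_const,
        (toR_injective d).eq_iff]
    simp [Finset.sum_apply, this, genSeries]
  rw [hsum]
  refine ⟨(polyhedralSeries d).sum_mem fun m hm => (polyhedralSeries d).zsmul_mem (hpt m hm) _, ?_⟩
  rw [phi_sum_zsmul hφ _ _ _ hpt, sigmaSet, finsum_mem_eq_finite_toFinset_sum _ hP]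
  refine Finset.sum_congr rfl fun m _ => ?_
  rw [Int.cast_one, one_mul, phi_famCone_translate hφ, phi_genSeries_origin hφ, mul_one]

/-- The affine combinations of `V` whose coefficients are nonnegative on `I`. -/
def relaxedHull (d : ℕ) (V I : Finset (Fin d → ℝ)) : Set (Fin d → ℝ) :=
  {y | ∃ mu : (Fin d → ℝ) → ℝ, (∀ u ∈ I, 0 ≤ mu u) ∧ ∑ u ∈ V, mu u = 1 ∧
    ∑ u ∈ V, mu u • u = y}

lemma sum_genSeries_relaxedHull (d : ℕ) (V : Finset (Fin d → ℝ)) :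
    ∑ I ∈ V.powerset, (-1 : ℤ) ^ I.card • genSeries d (relaxedHull d V I) = 0 := by
  funext m
  let L : Set ((Fin d → ℝ) → ℝ) := {mu | ∑ u ∈ V, mu u = 1 ∧ ∑ u ∈ V, mu u • u = toR d m}
  have hL : Convex ℝ L := by
    rintro x ⟨hx, hx'⟩ y ⟨hy, hy'⟩ a b _ _ hab
    refine ⟨?_, ?_⟩
    · simp only [Pi.add_apply, Pi.smul_apply, smul_eq_mul, Finset.sum_add_distrib,
        ← Finset.mul_sum, hx, hy, mul_one, hab]
    · simp only [Pi.add_apply, Pi.smul_apply, smul_eq_mul, add_smul, mul_smul,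
        Finset.sum_add_distrib, ← Finset.smul_sum, hx', hy']
      rw [← add_smul, hab, one_smul]
  have key := sum_nonemptyInd_face_eq
    (fun u => -LinearMap.proj (R := ℝ) (φ := fun _ : Fin d → ℝ => ℝ) u) V hL
  simp only [LinearMap.neg_apply, LinearMap.proj_apply, neg_nonneg, neg_nonpos] at key
  have hempty : ∀ I : Finset (Fin d → ℝ), nonemptyInd
      (L ∩ {x | (∀ u ∈ V, x u ≤ 0) ∧ ∀ u ∈ I, -x u = 0}) = 0 := by
    intro I
    refine if_neg ?_
    rintro ⟨x, ⟨hx, -⟩, hneg, -⟩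
    have := Finset.sum_nonpos hneg
    linarith
  simp only [hempty, mul_zero, Finset.sum_const_zero] at key
  have hmem : ∀ I : Finset (Fin d → ℝ), toR d m ∈ relaxedHull d V I ↔
      (L ∩ {x | ∀ u ∈ I, 0 ≤ x u}).Nonempty := fun I =>
    ⟨fun ⟨x, h, h'⟩ => ⟨x, h', h⟩, fun ⟨x, h, h'⟩ => ⟨x, h', h⟩⟩
  simp only [Finset.sum_apply, Pi.smul_apply, genSeries_apply_eq_nonemptyInd d (hmem _),
    Pi.zero_apply]
  simp only [zsmul_eq_mul]
  exact_mod_cast key.symm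

lemma relaxedHull_self (d : ℕ) (V : Finset (Fin d → ℝ)) :
    relaxedHull d V V = convexHull ℝ (V : Set (Fin d → ℝ)) := by
  ext y
  rw [Finset.mem_convexHull']
  rfl

lemma relaxedHull_erase {d : ℕ} {V : Finset (Fin d → ℝ)} {v : Fin d → ℝ} (hv : v ∈ V) :
    relaxedHull d V (V.erase v) =
      {y | ∃ t : ℝ, 0 < t ∧ v + t • (y - v) ∈ convexHull ℝ (V : Set (Fin d → ℝ))} := by
  have hδ : ∑ u ∈ V, (Pi.single v 1 : (Fin d → ℝ) → ℝ) u = 1 := by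
    simp [Pi.single_apply, hv]
  have hδ' : ∑ u ∈ V, (Pi.single v 1 : (Fin d → ℝ) → ℝ) u • u = v := by
    simp [Pi.single_apply, hv]
  ext y
  simp only [← relaxedHull_self]
  constructor
  · rintro ⟨mu, h0, h1, rfl⟩
    have hden : 0 < 1 + |1 - mu v| := by positivity
    have ht : 0 < (1 + |1 - mu v|)⁻¹ := inv_pos.mpr hden
    set t := (1 + |1 - mu v|)⁻¹ with htdef
    refine ⟨t, ht, Pi.single v 1 + t • (mu - Pi.single v 1), fun u hu => ?_, ?_, ?_⟩
    · by_cases huv : u = v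
      · subst huv
        simp only [Pi.add_apply, Pi.smul_apply, Pi.sub_apply, Pi.single_eq_same, smul_eq_mul]
        have h2 : t * (1 + |1 - mu u|) = 1 := inv_mul_cancel₀ hden.ne'
        have h3 := le_abs_self (1 - mu u)
        nlinarith
      · simp only [Pi.add_apply, Pi.smul_apply, Pi.sub_apply, Pi.single_eq_of_ne huv, smul_eq_mul,
          zero_add, sub_zero]
        exact mul_nonneg ht.le (h0 u (Finset.mem_erase.mpr ⟨huv, hu⟩))
    · simp only [Pi.add_apply, Pi.smul_apply, Pi.sub_apply, smul_eq_mul, Finset.sum_add_distrib,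
        ← Finset.mul_sum, Finset.sum_sub_distrib, hδ, h1]
      ring
    · simp only [Pi.add_apply, Pi.smul_apply, Pi.sub_apply, smul_eq_mul, add_smul, mul_smul,
        sub_smul, Finset.sum_add_distrib, ← Finset.smul_sum, Finset.sum_sub_distrib, hδ']
  · rintro ⟨t, ht, nu, h0, h1, h2⟩
    refine ⟨Pi.single v 1 + t⁻¹ • (nu - Pi.single v 1), fun u hu => ?_, ?_, ?_⟩
    · obtain ⟨huv, hu⟩ := Finset.mem_erase.mp hu
      simp only [Pi.add_apply, Pi.smul_apply, Pi.sub_apply, Pi.single_eq_of_ne huv, smul_eq_mul,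
        zero_add, sub_zero]
      exact mul_nonneg (inv_pos.mpr ht).le (h0 u hu)
    · simp only [Pi.add_apply, Pi.smul_apply, Pi.sub_apply, smul_eq_mul, Finset.sum_add_distrib,
        ← Finset.mul_sum, Finset.sum_sub_distrib, hδ, h1]
      ring
    · simp only [Pi.add_apply, Pi.smul_apply, Pi.sub_apply, smul_eq_mul, add_smul, mul_smul,
        sub_smul, Finset.sum_add_distrib, ← Finset.smul_sum, Finset.sum_sub_distrib, hδ', h2]
      rw [add_sub_cancel_left, smul_smul, inv_mul_cancel₀ ht.ne', one_smul]
      abel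

lemma relaxedHull_add_smul_sub_mem {d : ℕ} {V I : Finset (Fin d → ℝ)} {u v y : Fin d → ℝ}
    (hu : u ∈ V \ I) (hv : v ∈ V \ I) (r : ℝ) (hy : y ∈ relaxedHull d V I) :
    y + r • (u - v) ∈ relaxedHull d V I := by
  obtain ⟨mu, h0, h1, rfl⟩ := hy
  rw [Finset.mem_sdiff] at hu hv
  refine ⟨mu + r • (Pi.single u 1 - Pi.single v 1), fun x hx => ?_, ?_, ?_⟩
  · have hxu : x ≠ u := fun h => hu.2 (h ▸ hx)
    have hxv : x ≠ v := fun h => hv.2 (h ▸ hx)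
    simpa [hxu, hxv] using h0 x hx
  · simp [Finset.sum_add_distrib, ← Finset.mul_sum, Finset.sum_sub_distrib, h1, Pi.single_apply,
      hu.1, hv.1]
  · simp [Finset.sum_add_distrib, add_smul, sub_smul, mul_smul, ← Finset.smul_sum,
      Finset.sum_sub_distrib, Pi.single_apply, hu.1, hv.1]

lemma exists_common_denominator {d : ℕ} (V : Finset (Fin d → ℝ))
    (hrat : ∀ v ∈ V, ∀ i, ∃ q : ℚ, v i = (q : ℝ)) :
    ∃ (N : ℝ) (z : (Fin d → ℝ) → Fin d → ℤ), 0 < N ∧ ∀ v ∈ V, toR d (z v) = N • v := by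
  choose! q hq using hrat
  obtain ⟨b, hb⟩ := IsLocalization.exist_integer_multiples (nonZeroDivisors ℤ)
    (V ×ˢ (Finset.univ : Finset (Fin d))) fun p => q p.1 p.2
  have hz : ∀ (v : Fin d → ℝ) (i : Fin d), ∃ z : ℤ, v ∈ V → (z : ℚ) = (b : ℤ) * q v i := by
    intro v i
    by_cases hv : v ∈ V
    · obtain ⟨z, hz⟩ := hb (v, i) (by simp [hv])
      refine ⟨z, fun _ => ?_⟩
      simpa [zsmul_eq_mul, Submonoid.smul_def] using hz
    · exact ⟨0, fun h => absurd h hv⟩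
  choose z hz using hz
  have hb0 : ((b : ℤ) : ℝ) ≠ 0 := Int.cast_ne_zero.mpr (nonZeroDivisors.coe_ne_zero b)
  refine ⟨(b : ℤ) * (b : ℤ), fun v i => b * z v i, mul_self_pos.mpr hb0, fun v hv => ?_⟩
  funext i
  have h : ((z v i : ℤ) : ℝ) = (b : ℤ) * v i := by
    rw [hq v hv i]
    exact_mod_cast congrArg (fun x : ℚ => (x : ℝ)) (hz v i hv)
  simp only [toR, Int.cast_mul, h, Pi.smul_apply, smul_eq_mul]
  ring

lemma relaxedHull_eq_famCone {d : ℕ} {V I : Finset (Fin d → ℝ)} {v : Fin d → ℝ} (hv : v ∈ V)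
    (hvI : v ∉ I) (hIV : I ⊆ V) {N : ℝ} (hN : 0 < N) {z : (Fin d → ℝ) → Fin d → ℤ}
    (hz : ∀ u ∈ V, toR d (z u) = N • u) :
    relaxedHull d V I = famCone d v
      (fun p : (Fin d → ℝ) ⊕ (Fin d → ℝ) => p.elim (fun u => z u - z v) (fun u => z v - z u))
      (V.disjSum (V \ I)) := by
  have hdir : ∀ a b : (Fin d → ℝ) → ℝ,
      v + (∑ u ∈ V, a u • toR d (z u - z v) + ∑ u ∈ V \ I, b u • toR d (z v - z u)) =
        v + ∑ u ∈ V, (N * (a u - if u ∈ I then 0 else b u)) • (u - v) := by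
    intro a b
    congr 1
    rw [← Finset.filter_notMem_eq_sdiff, Finset.sum_filter, ← Finset.sum_add_distrib]
    refine Finset.sum_congr rfl fun u hu => ?_
    rw [toR_sub, toR_sub, hz u hu, hz v hv]
    by_cases huI : u ∈ I <;> simp only [huI, not_true, not_false_iff, if_true, if_false] <;>
      module
  ext y
  simp only [famCone, Set.mem_ofPred_eq, Finset.sum_disjSum, Sum.elim_inl, Sum.elim_inr]
  constructor
  · rintro ⟨mu, h0, h1, rfl⟩
    refine ⟨Sum.elim (fun u => N⁻¹ * max (mu u) 0) fun u => N⁻¹ * max (-mu u) 0,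
      fun p _ => ?_, ?_⟩
    · rcases p with u | u <;> simp only [Sum.elim_inl, Sum.elim_inr] <;> positivity
    · simp only [Sum.elim_inl, Sum.elim_inr]
      rw [hdir (fun u => N⁻¹ * max (mu u) 0) fun u => N⁻¹ * max (-mu u) 0]
      have hcoef : ∀ u ∈ V, (N * (N⁻¹ * max (mu u) 0 -
          if u ∈ I then 0 else N⁻¹ * max (-mu u) 0)) • (u - v) = mu u • u - mu u • v := by
        intro u _
        rw [← smul_sub]
        congr 1
        have hsub : max (mu u) 0 - max (-mu u) 0 = mu u := by
          rcases le_total 0 (mu u) with h | h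
          · rw [max_eq_left h, max_eq_right (by linarith), sub_zero]
          · rw [max_eq_right h, max_eq_left (by linarith)]; ring
        split_ifs with huI
        · rw [max_eq_left (h0 u huI), sub_zero, mul_inv_cancel_left₀ hN.ne']
        · rw [← mul_sub, mul_inv_cancel_left₀ hN.ne', hsub]
      rw [Finset.sum_congr rfl hcoef, Finset.sum_sub_distrib, ← Finset.sum_smul, h1, one_smul]
      abel
  · rintro ⟨lam, h0, rfl⟩
    rw [hdir (fun u => lam (Sum.inl u)) fun u => lam (Sum.inr u)]
    set nu : (Fin d → ℝ) → ℝ :=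
      fun u => N * (lam (Sum.inl u) - if u ∈ I then 0 else lam (Sum.inr u)) with hnu
    have hδ : ∑ u ∈ V, (Pi.single v (1 - ∑ x ∈ V, nu x) : (Fin d → ℝ) → ℝ) u =
        1 - ∑ x ∈ V, nu x := by
      simp [Pi.single_apply, hv]
    have hδ' : ∑ u ∈ V, (Pi.single v (1 - ∑ x ∈ V, nu x) : (Fin d → ℝ) → ℝ) u • u =
        (1 - ∑ x ∈ V, nu x) • v := by
      simp [Pi.single_apply, hv]
    refine ⟨nu + Pi.single v (1 - ∑ x ∈ V, nu x), fun u hu => ?_, ?_, ?_⟩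
    · have huv : u ≠ v := fun h => hvI (h ▸ hu)
      simp only [Pi.add_apply, Pi.single_eq_of_ne huv, add_zero, hnu, hu, if_true, sub_zero]
      exact mul_nonneg hN.le (h0 _ (by simp [hIV hu]))
    · simp only [Pi.add_apply, Finset.sum_add_distrib, hδ]
      ring
    · simp only [Pi.add_apply, add_smul, Finset.sum_add_distrib, hδ', smul_sub,
        Finset.sum_sub_distrib, ← Finset.sum_smul, sub_smul, one_smul]
      abel

lemma finite_integer_points_convexHull (d : ℕ) (V : Finset (Fin d → ℝ)) :
    {m : Fin d → ℤ | toR d m ∈ convexHull ℝ (V : Set (Fin d → ℝ))}.Finite := by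
  have hbdd : Bornology.IsBounded (convexHull ℝ (V : Set (Fin d → ℝ))) :=
    isBounded_convexHull.mpr V.finite_toSet.isBounded
  obtain ⟨R, hR⟩ := hbdd.exists_norm_le
  refine (Set.finite_Icc (fun _ => -⌈R⌉) (fun _ => ⌈R⌉)).subset fun m hm => ?_
  have h : ∀ i, |(m i : ℝ)| ≤ (⌈R⌉ : ℝ) := fun i =>
    ((norm_le_pi_norm (toR d m) i).trans (hR _ hm)).trans (Int.le_ceil R)
  refine ⟨fun i => ?_, fun i => ?_⟩
  · exact_mod_cast (abs_le.mp (h i)).1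
  · exact_mod_cast (abs_le.mp (h i)).2

/-- Brion's formula does not need the points of `V` to be vertices. -/
theorem sigmaSet_convexHull_eq_sum_phi {d : ℕ} (V : Finset (Fin d → ℝ))
    (hrat : ∀ v ∈ V, ∀ i, ∃ q : ℚ, v i = (q : ℝ))
    {φ : ((Fin d → ℤ) → ℂ) → RatF d} (hφ : IsPhi d φ) :
    sigmaSet d (convexHull ℝ (V : Set (Fin d → ℝ))) =
      ∑ v ∈ V, φ (genSeries d (relaxedHull d V (V.erase v))) := by
  obtain ⟨N, z, hN, hz⟩ := exists_common_denominator V hrat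
  obtain ⟨hP, hφP⟩ := genSeries_finite_mem_and_phi hφ (finite_integer_points_convexHull d V)
  rw [← relaxedHull_self] at hP hφP ⊢
  have hmem : ∀ I ∈ V.powerset, MemPL d (genSeries d (relaxedHull d V I)) := by
    intro I hI
    rw [Finset.mem_powerset] at hI
    by_cases hVI : I = V
    · rwa [hVI]
    · obtain ⟨v, hv, hvI⟩ := Finset.exists_of_ssubset (Finset.ssubset_iff_subset_ne.mpr ⟨hI, hVI⟩)
      rw [relaxedHull_eq_famCone hv hvI hI hN hz]
      exact genSeries_famCone_mem _ _ _ _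
  have hline : ∀ I ∈ V.powerset, I ∉ insert V (V.image V.erase) →
      (((-1) ^ I.card : ℤ) : RatF d) * φ (genSeries d (relaxedHull d V I)) = 0 := by
    intro I hI hI'
    rw [Finset.mem_insert, Finset.mem_image, not_or] at hI'
    have hsub := Finset.mem_powerset.mp hI
    obtain ⟨u, hu⟩ : (V \ I).Nonempty := by
      rw [Finset.sdiff_nonempty]
      exact fun h => hI'.1 (hsub.antisymm h)
    obtain ⟨v, hv, huv⟩ : ∃ v ∈ V \ I, v ≠ u := by
      by_contra! h
      refine hI'.2 ⟨u, (Finset.mem_sdiff.mp hu).1, ?_⟩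
      rw [← Finset.sdiff_singleton_eq_erase,
        ← Finset.eq_singleton_iff_unique_mem.mpr ⟨hu, h⟩, Finset.sdiff_sdiff_eq_self hsub]
    have hdiff : toR d (z u - z v) = N • (u - v) := by
      rw [toR_sub, hz u (Finset.mem_sdiff.mp hu).1, hz v (Finset.mem_sdiff.mp hv).1, smul_sub]
    have hne : z u - z v ≠ 0 := by
      intro h
      rw [h] at hdiff
      have h0 : toR d 0 = 0 := by funext i; simp [toR]
      rw [h0, eq_comm, smul_eq_zero, sub_eq_zero] at hdiff
      exact hdiff.elim hN.ne' fun h => huv h.symm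
    rw [phi_eq_zero_of_periodic hφ (hmem I hI) hne, mul_zero]
    intro m
    have hiff : toR d (m - (z u - z v)) ∈ relaxedHull d V I ↔ toR d m ∈ relaxedHull d V I := by
      rw [toR_sub, hdiff]
      constructor
      · intro h
        have := relaxedHull_add_smul_sub_mem hu hv N h
        rwa [sub_add_cancel] at this
      · intro h
        have := relaxedHull_add_smul_sub_mem hv hu N h
        rwa [← neg_sub u v, smul_neg, ← sub_eq_add_neg] at this
    simp only [genSeries, hiff]
  have hφ0 : φ 0 = 0 := by
    simpa using phi_sum_zsmul hφ (∅ : Finset Unit) (fun _ => 0) (fun _ => 0) (by simp)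
  have key := phi_sum_zsmul hφ V.powerset (fun I => (-1 : ℤ) ^ I.card)
    (fun I => genSeries d (relaxedHull d V I)) hmem
  have himage : V ∉ V.image V.erase := by
    rw [Finset.mem_image]
    rintro ⟨v, hv, h⟩
    exact Finset.notMem_erase v V (h.symm ▸ hv)
  have hcard : ∀ v ∈ V, (-1 : ℤ) ^ (V.erase v).card = -(-1) ^ V.card := fun v hv => by
    rw [← Finset.card_erase_add_one hv, pow_succ]
    ring
  rw [sum_genSeries_relaxedHull, hφ0, ← Finset.sum_subset ?_ hline, Finset.sum_insert himage,
    Finset.sum_image V.erase_injOn, Finset.sum_congr rfl fun v hv => by rw [hcard v hv],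
    ← Finset.mul_sum, Int.cast_neg, neg_mul, ← sub_eq_add_neg, ← mul_sub, hφP] at key
  · refine sub_eq_zero.mp ((mul_eq_zero.mp key.symm).resolve_left ?_)
    exact Int.cast_ne_zero.mpr (pow_ne_zero _ (by norm_num))
  · intro I hI
    rw [Finset.mem_insert, Finset.mem_image] at hI
    rw [Finset.mem_powerset]
    rcases hI with rfl | ⟨v, -, rfl⟩
    · exact Finset.Subset.refl _
    · exact Finset.erase_subset _ _

/-- **Brion's Formula.** For a polytope `P` (the convex hull of its vertex
set `V`, required to consist of rational points) with vertex tangent cones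
`K_v = {y : v + t(y - v) ∈ P for some t > 0}` (which equals `v` plus the cone generated by
the edge directions at `v`), one has `σ_P(x) = Σ_{v vertex} φ(S_{K_v})` in `ℂ(x₁,…,x_d)`. -/
theorem statement8 (d : ℕ) (V : Finset (Fin d → ℝ))
    (hrat : ∀ v ∈ V, ∀ i, ∃ q : ℚ, v i = (q : ℝ))
    (hvert : (V : Set (Fin d → ℝ)) =
      Set.extremePoints ℝ (convexHull ℝ (V : Set (Fin d → ℝ))))
    (φ : ((Fin d → ℤ) → ℂ) → RatF d) (hφ : IsPhi d φ) :
    sigmaSet d (convexHull ℝ (V : Set (Fin d → ℝ))) =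
      ∑ v ∈ V, φ (genSeries d
        {y | ∃ t : ℝ, 0 < t ∧ v + t • (y - v) ∈ convexHull ℝ (V : Set (Fin d → ℝ))}) := by
  rw [sigmaSet_convexHull_eq_sum_phi V hrat hφ]
  exact Finset.sum_congr rfl fun v hv => by rw [relaxedHull_erase hv]

end
end
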